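/- arXiv:1801.08731 — 5 statements merged into one kernel-verified Lean document; each statement's English description precedes it below -/
import Mathlib

section
/- As x → ∞, w(x) = x·exp(−(√2 + o(1))·√(log x · log log x)). Equivalently, (log x − log w(x))/√(log x · log log x) → √2 as x → ∞. -/
open Real Filter

/-- `ProductIsPerfectPower x w` : there exist `m ≥ 1`, `y ≥ 2` and integers
`1 ≤ n₁ < n₂ < ⋯ < n_m ≤ x` with `n₁ ⋯ n_m = y ^ w`. -/
def ProductIsPerfectPower (x : ℝ) (w : ℕ) : Prop :=
  1 ≤ w ∧ ∃ m : ℕ, 1 ≤ m ∧ ∃ y : ℕ, 2 ≤ y ∧ ∃ n : Fin m → ℕ,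
    StrictMono n ∧ (∀ i, 1 ≤ n i) ∧ (∀ i, (n i : ℝ) ≤ x) ∧ ∏ i, n i = y ^ w

lemma productIsPerfectPower_of_finset {x : ℝ} {w y : ℕ} (hw : 1 ≤ w) (hy : 2 ≤ y)
    (A : Finset ℕ) (hpos : ∀ n ∈ A, 1 ≤ n) (hle : ∀ n ∈ A, (n : ℝ) ≤ x)
    (hprod : ∏ n ∈ A, n = y ^ w) : ProductIsPerfectPower x w := by
  refine ⟨hw, A.card, ?_, y, hy, A.orderEmbOfFin rfl, (A.orderEmbOfFin rfl).strictMono,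
    fun i => hpos _ (A.orderEmbOfFin_mem rfl i), fun i => hle _ (A.orderEmbOfFin_mem rfl i), ?_⟩
  · rw [Nat.one_le_iff_ne_zero, Ne, Finset.card_eq_zero]
    rintro rfl
    have : 1 < y ^ w := Nat.one_lt_pow (by omega) hy
    simp at hprod
    omega
  · rw [← hprod, ← Finset.prod_image (f := fun n => n) (s := Finset.univ)
      (g := A.orderEmbOfFin rfl)]
    · rw [Finset.image_orderEmbOfFin_univ]
    · exact fun i _ j _ h => (A.orderEmbOfFin rfl).injective h

/-- Multiplying every element of `A` by every element of a set `Q` of primes not dividing the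
elements of `A` gives `#A * #Q` distinct integers. -/
lemma prod_image_mul_of_not_dvd {A Q : Finset ℕ} (hQ : ∀ p ∈ Q, p.Prime)
    (hA : ∀ n ∈ A, ∀ p ∈ Q, ¬ p ∣ n) :
    ((A ×ˢ Q).image fun z => z.1 * z.2).card = A.card * Q.card ∧
      ∏ n ∈ (A ×ˢ Q).image (fun z => z.1 * z.2), n =
        (∏ n ∈ A, n) ^ Q.card * (∏ p ∈ Q, p) ^ A.card := by
  have hinj : Set.InjOn (fun z : ℕ × ℕ => z.1 * z.2) (A ×ˢ Q : Finset (ℕ × ℕ)) := by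
    rintro ⟨a, p⟩ h1 ⟨b, q⟩ h2 h
    simp only [Finset.coe_product, Set.mem_prod, Finset.mem_coe] at h1 h2 h
    have hpq : p = q := by
      have h3 : p ∣ b * q := h ▸ dvd_mul_left p a
      rcases (hQ p h1.2).dvd_mul.1 h3 with h4 | h4
      · exact absurd h4 (hA b h2.1 p h1.2)
      · exact (Nat.prime_dvd_prime_iff_eq (hQ p h1.2) (hQ q h2.2)).1 h4
    subst hpq
    rw [Nat.mul_left_inj (hQ p h1.2).ne_zero] at h
    rw [h]
  refine ⟨by rw [Finset.card_image_of_injOn hinj, Finset.card_product], ?_⟩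
  rw [Finset.prod_image hinj, Finset.prod_mul_distrib, Finset.prod_product, Finset.prod_product]
  simp [Finset.prod_pow, Finset.prod_const]

lemma exists_finset_prod_eq_pow {N : ℕ} (hN : 1 ≤ N) {B : ℕ → ℝ} (hB0 : ∀ j, 0 ≤ B j)
    (K : ℕ) (hB : ∀ j ≤ K, ∀ i < N * 2 ^ (j + 1), (Nat.nth Nat.Prime i : ℝ) ≤ B j) :
    ∃ (A : Finset ℕ) (y : ℕ), 2 ≤ y ∧ A.card = ∏ j ∈ Finset.range (K + 1), N * 2 ^ j ∧
      ∏ n ∈ A, n = y ^ ∏ j ∈ Finset.range K, N * 2 ^ j ∧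
      ∀ n ∈ A, 1 ≤ n ∧ (n : ℝ) ≤ ∏ j ∈ Finset.range (K + 1), B j ∧
        ∀ i, N * 2 ^ (K + 1) ≤ i → ¬ Nat.nth Nat.Prime i ∣ n := by
  have nthinj : Function.Injective (Nat.nth Nat.Prime) :=
    Nat.nth_injective Nat.infinite_setOfPred_prime
  set Q : ℕ → Finset ℕ := fun j =>
    (Finset.Ico (N * 2 ^ j) (N * 2 ^ (j + 1))).image (Nat.nth Nat.Prime) with hQdef
  have hQcard : ∀ j, (Q j).card = N * 2 ^ j := by
    intro j
    rw [hQdef, Finset.card_image_of_injective _ nthinj, Nat.card_Ico, pow_succ, ← mul_assoc]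
    omega
  have hQp : ∀ j, ∀ p ∈ Q j, p.Prime := by
    intro j p hp
    obtain ⟨i, -, rfl⟩ := Finset.mem_image.1 hp
    exact Nat.prime_nth_prime i
  have hQne : ∀ j, 2 ≤ ∏ p ∈ Q j, p := by
    intro j
    have hne : (Q j).Nonempty := by
      rw [← Finset.card_pos, hQcard]; positivity
    obtain ⟨p, hp⟩ := hne
    exact (hQp j p hp).two_le.trans (Nat.le_of_dvd
      (Finset.prod_pos fun q hq => (hQp j q hq).pos) (Finset.dvd_prod_of_mem _ hp))
  have hQB : ∀ j ≤ K, ∀ p ∈ Q j, (p : ℝ) ≤ B j := by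
    intro j hj p hp
    obtain ⟨i, hi, rfl⟩ := Finset.mem_image.1 hp
    exact hB j hj i (Finset.mem_Ico.1 hi).2
  have hQnd : ∀ j, ∀ p ∈ Q j, ∀ i, N * 2 ^ (j + 1) ≤ i → ¬ Nat.nth Nat.Prime i ∣ p := by
    intro j p hp i hi hd
    have h1 := (Nat.prime_dvd_prime_iff_eq (Nat.prime_nth_prime i) (hQp j p hp)).1 hd
    obtain ⟨i', hi', rfl⟩ := Finset.mem_image.1 hp
    have := nthinj h1
    have := (Finset.mem_Ico.1 hi').2
    omega
  have hQge : ∀ j, ∀ p ∈ Q j, ∃ i, N * 2 ^ j ≤ i ∧ p = Nat.nth Nat.Prime i := by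
    intro j p hp
    obtain ⟨i, hi, rfl⟩ := Finset.mem_image.1 hp
    exact ⟨i, (Finset.mem_Ico.1 hi).1, rfl⟩
  clear_value Q
  clear hB
  induction K with
  | zero =>
    refine ⟨Q 0, ∏ p ∈ Q 0, p, hQne 0, by simp [hQcard], by simp, fun n hn => ?_⟩
    exact ⟨(hQp 0 n hn).one_le, by simpa using hQB 0 le_rfl n hn, hQnd 0 n hn⟩
  | succ K ih =>
    obtain ⟨A, y, hy, hcard, hprod, hA⟩ := ih fun j hj => hQB j (by omega)
    have hAQ : ∀ n ∈ A, ∀ p ∈ Q (K + 1), ¬ p ∣ n := by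
      intro n hn p hp
      obtain ⟨i, hi, rfl⟩ := hQge _ p hp
      exact (hA n hn).2.2 i hi
    obtain ⟨hc, hpr⟩ := prod_image_mul_of_not_dvd (hQp (K + 1)) hAQ
    refine ⟨(A ×ˢ Q (K + 1)).image fun z => z.1 * z.2, y ^ 2 * ∏ p ∈ Q (K + 1), p,
      ?_, ?_, ?_, ?_⟩
    · nlinarith [hQne (K + 1), Nat.pow_le_pow_left hy 2]
    · rw [hc, hcard, hQcard, ← Finset.prod_range_succ]
    · rw [hpr, hprod, hcard, hQcard, mul_pow, ← pow_mul, ← pow_mul]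
      congr 2
      rw [Finset.prod_range_succ _ K]
      ring
    · intro n hn
      obtain ⟨⟨a, p⟩, hap, rfl⟩ := Finset.mem_image.1 hn
      obtain ⟨ha, hp⟩ := Finset.mem_product.1 hap
      obtain ⟨h1, h2, h3⟩ := hA a ha
      refine ⟨Nat.mul_pos h1 (hQp _ p hp).pos, ?_, ?_⟩
      · rw [Finset.prod_range_succ]
        push_cast
        exact mul_le_mul h2 (hQB _ le_rfl p hp) (Nat.cast_nonneg _)
          (Finset.prod_nonneg fun j _ => hB0 j)
      · intro i hi hd
        rcases (Nat.prime_nth_prime i).dvd_mul.1 hd with h | h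
        · exact h3 i (le_trans (Nat.mul_le_mul_left _ (Nat.pow_le_pow_right (by omega)
            (by omega))) hi) h
        · exact hQnd _ p hp i hi h

lemma nth_prime_le (i : ℕ) :
    (Nat.nth Nat.Prime i : ℝ) ≤ 64 * (i + 1) * log (32 * (i + 1)) := by
  set p := Nat.nth Nat.Prime i with hp
  have hpp : p.Prime := Nat.prime_nth_prime i
  have hp2 : (2 : ℝ) ≤ p := by exact_mod_cast hpp.two_le
  have hcount : Nat.primeCounting p = i + 1 := by
    rw [Nat.primeCounting, Nat.primeCounting', Nat.count_succ, if_pos hpp, hp,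
      Nat.count_nth_of_infinite Nat.infinite_setOfPred_prime]
  have h1 := Chebyshev.pi_ge p
  have hlogp : 0 < log (p : ℝ) := log_pos (by linarith)
  rw [hcount, div_le_iff₀ hlogp] at h1
  push_cast at h1
  have h3 : log ((p : ℝ) + 1) ≤ log 2 + 1 / 2 + (p - 2) / 3 := by
    have e : (p : ℝ) + 1 = 2 * (3 / 2) * ((p + 1) / 3) := by ring
    rw [e, log_mul (by norm_num) (by positivity), log_mul (by norm_num) (by norm_num)]
    have := log_le_sub_one_of_pos (show (0 : ℝ) < 3 / 2 by norm_num)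
    have := log_le_sub_one_of_pos (show (0 : ℝ) < (p + 1) / 3 by positivity)
    linarith
  have h4 : (p : ℝ) ≤ 16 * ((i + 1) * log p) := by
    nlinarith [log_two_gt_d9]
  have h5 : log (p : ℝ) ≤ 2 * √p := by
    have := log_le_sub_one_of_pos (show (0 : ℝ) < √p by positivity)
    rw [log_sqrt (by positivity)] at this
    linarith
  have h6 : √(p : ℝ) ≤ 32 * (i + 1) := by
    have hs : (p : ℝ) = √p * √p := (mul_self_sqrt (by positivity)).symm
    have hs0 : 0 < √(p : ℝ) := by positivity
    have : √(p : ℝ) * √p ≤ (32 * (i + 1)) * √p := by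
      rw [← hs]
      nlinarith [show (0 : ℝ) ≤ (i : ℝ) + 1 by positivity]
    exact le_of_mul_le_mul_right this hs0
  have h7 : log (p : ℝ) ≤ 2 * log (32 * (i + 1)) := by
    have := log_le_log (by positivity) h6
    rw [log_sqrt (by positivity)] at this
    linarith
  nlinarith [show (0 : ℝ) ≤ (i : ℝ) + 1 by positivity]

lemma log_prod_range_mul_two_pow {c : ℝ} (hc : 0 < c) (K : ℕ) :
    log (∏ j ∈ Finset.range K, c * 2 ^ j) = K * log c + K * (K - 1) / 2 * log 2 := by
  induction K with
  | zero => simp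
  | succ K ih =>
    rw [Finset.prod_range_succ, log_mul (Finset.prod_ne_zero_iff.2 fun j _ => by positivity)
      (by positivity), ih, log_mul hc.ne' (by positivity), log_pow]
    push_cast
    ring

lemma productIsPerfectPower_prod_range {x : ℝ} (hx : 0 < x) {N : ℕ} (hN : 1 ≤ N) (K : ℕ) {G : ℝ}
    (hG : log (32 * (N * 2 ^ (K + 1))) ≤ G)
    (hle : (K + 1) * log (128 * N * G) + (K + 1) * K / 2 * log 2 ≤ log x) :
    ProductIsPerfectPower x (∏ j ∈ Finset.range K, N * 2 ^ j) := by
  have hN' : (1 : ℝ) ≤ N := by exact_mod_cast hN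
  have hG0 : 0 < G := by
    refine lt_of_lt_of_le (log_pos ?_) hG
    have : (1 : ℝ) ≤ 2 ^ (K + 1) := one_le_pow₀ (by norm_num)
    nlinarith
  have hB : ∀ j ≤ K, ∀ i < N * 2 ^ (j + 1),
      (Nat.nth Nat.Prime i : ℝ) ≤ 128 * N * G * 2 ^ j := by
    intro j hj i hi
    have h1 : (i : ℝ) + 1 ≤ N * 2 ^ (j + 1) := by exact_mod_cast hi
    have h2 : (N : ℝ) * 2 ^ (j + 1) ≤ N * 2 ^ (K + 1) := by
      gcongr
      · norm_num
    have h3 : log (32 * (i + 1)) ≤ G :=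
      (log_le_log (by positivity) (by linarith)).trans hG
    calc (Nat.nth Nat.Prime i : ℝ) ≤ 64 * (i + 1) * log (32 * (i + 1)) := nth_prime_le i
      _ ≤ 64 * (N * 2 ^ (j + 1)) * G := by
        gcongr
        exact log_nonneg (by linarith [(Nat.cast_nonneg i : (0 : ℝ) ≤ i)])
      _ = 128 * N * G * 2 ^ j := by ring
  obtain ⟨A, y, hy, -, hprod, hA⟩ := exists_finset_prod_eq_pow hN
    (B := fun j => 128 * N * G * 2 ^ j) (fun j => by positivity) K hB
  refine productIsPerfectPower_of_finset
    (Nat.succ_le_iff.2 (Finset.prod_pos fun j _ => by positivity)) hy A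
    (fun n hn => (hA n hn).1) (fun n hn => (hA n hn).2.1.trans ?_) hprod
  rw [← log_le_log_iff (Finset.prod_pos fun j _ => by positivity) hx,
    log_prod_range_mul_two_pow (by positivity)]
  push_cast
  convert hle using 2
  ring

lemma exists_productIsPerfectPower_le_log {x : ℝ} (hx : 0 < x) {J : ℕ} (hJ : 1 ≤ J) {G : ℝ}
    (hG1 : 1 ≤ G) (hG : log x / J + J ≤ G) (hJG : 5 + log G + J ≤ log x / J) :
    ∃ w, ProductIsPerfectPower x w ∧
      log x - log x / J - J * (log G + 6) ≤ log w := by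
  obtain ⟨K, rfl⟩ : ∃ K, J = K + 1 := ⟨J - 1, by omega⟩
  push_cast at *
  have hl2 := log_two_gt_d9
  have hl2' := log_two_lt_d9
  have hlG : 0 ≤ log G := log_nonneg hG1
  have hK : (0 : ℝ) ≤ K := Nat.cast_nonneg K
  set q := log x / (K + 1) with hq
  have hqx : log x = (K + 1) * q := by rw [hq]; field_simp
  have h128 : log 128 = 7 * log 2 := by
    rw [show (128 : ℝ) = 2 ^ 7 by norm_num, log_pow]; norm_num
  have h32 : log 32 = 5 * log 2 := by
    rw [show (32 : ℝ) = 2 ^ 5 by norm_num, log_pow]; norm_num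
  set t := q - 7 * log 2 - log G - K / 2 * log 2 with ht
  have ht0 : 0 ≤ t := by nlinarith
  have het : 1 ≤ exp t := one_le_exp ht0
  set N := ⌊exp t⌋₊ with hN
  have hN1 : 1 ≤ N := Nat.le_floor (by simpa using het)
  have hN1' : (1 : ℝ) ≤ N := by exact_mod_cast hN1
  have hNle : log N ≤ t := by
    rw [log_le_iff_le_exp (by positivity)]
    exact Nat.floor_le (by positivity)
  have hNge : t - log 2 ≤ log N := by
    rw [le_log_iff_exp_le (by positivity), exp_sub, exp_log (by norm_num)]
    have := Nat.lt_floor_add_one (exp t)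
    rw [← hN] at this
    linarith
  refine ⟨_, productIsPerfectPower_prod_range hx hN1 K (G := G) ?_ ?_, ?_⟩
  · rw [log_mul (by norm_num) (by positivity), log_mul (by positivity) (by positivity), log_pow,
      h32]
    push_cast
    nlinarith
  · rw [log_mul (by positivity) (by positivity), log_mul (by norm_num) (by positivity), h128, hqx]
    have : (K + 1 : ℝ) * log N ≤ (K + 1) * t := by gcongr
    rw [ht] at this
    linarith
  · push_cast
    rw [log_prod_range_mul_two_pow (by positivity), hqx]
    have : (K : ℝ) * (t - log 2) ≤ K * log N := by gcongr
    have h2 : (K : ℝ) * log 2 ≤ K * 0.6931471808 := by gcongr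
    rw [ht] at this
    nlinarith

/-- The map `n ↦ n ^ (-s)` as a monoid homomorphism. -/
noncomputable def rpowNegHom (s : ℝ) : ℕ →* ℝ where
  toFun n := (n : ℝ) ^ (-s)
  map_one' := by simp
  map_mul' m n := by push_cast; exact mul_rpow (Nat.cast_nonneg _) (Nat.cast_nonneg _)

lemma rpowNegHom_apply (s : ℝ) (n : ℕ) : rpowNegHom s n = (n : ℝ) ^ (-s) := rfl

lemma hasSum_smoothNumbers_rpow_neg {s : ℝ} (hs : 0 < s) (N : ℕ) :
    HasSum (fun m : N.smoothNumbers => ((m : ℕ) : ℝ) ^ (-s))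
      (∏ p ∈ N.primesBelow, (1 - (p : ℝ) ^ (-s))⁻¹) := by
  refine (EulerProduct.summable_and_hasSum_smoothNumbers_prod_primesBelow_geometric
    (f := rpowNegHom s) (fun {p} hp => ?_) N).2
  rw [rpowNegHom_apply, norm_of_nonneg (by positivity)]
  exact rpow_lt_one_of_one_lt_of_neg (by exact_mod_cast hp.one_lt) (by linarith)

lemma sum_smoothNumbers_rpow_neg_le {σ : ℝ} (hσ : 1 / 2 ≤ σ) (N : ℕ) {S : Finset ℕ}
    (hS : ∀ m ∈ S, m ∈ N.smoothNumbers) :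
    ∑ m ∈ S, (m : ℝ) ^ (-σ) ≤ exp (4 * ∑ p ∈ N.primesBelow, (p : ℝ) ^ (-σ)) := by
  have hsum := hasSum_smoothNumbers_rpow_neg (by linarith : 0 < σ) N
  calc ∑ m ∈ S, (m : ℝ) ^ (-σ)
      = ∑ m ∈ S.subtype (· ∈ N.smoothNumbers), ((m : ℕ) : ℝ) ^ (-σ) :=
        (Finset.sum_subtype_of_mem (fun m : ℕ => (m : ℝ) ^ (-σ)) hS).symm
    _ ≤ ∏ p ∈ N.primesBelow, (1 - (p : ℝ) ^ (-σ))⁻¹ :=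
        sum_le_hasSum _ (fun m _ => by positivity) hsum
    _ ≤ ∏ p ∈ N.primesBelow, exp (4 * (p : ℝ) ^ (-σ)) := by
        refine Finset.prod_le_prod (fun p hp => ?_) fun p hp => ?_
        · have hp' := Nat.prime_of_mem_primesBelow hp
          exact inv_nonneg.2 (sub_nonneg.2 (rpow_le_one_of_one_le_of_nonpos
            (by exact_mod_cast hp'.one_le) (by linarith)))
        · have hp' := Nat.prime_of_mem_primesBelow hp
          have hp2 : (2 : ℝ) ≤ p := by exact_mod_cast hp'.two_le
          set t := (p : ℝ) ^ (-σ) with ht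
          have ht0 : 0 < t := by positivity
          have ht1 : t ≤ 3 / 4 := by
            calc t ≤ (p : ℝ) ^ (-(1 / 2) : ℝ) :=
                  rpow_le_rpow_of_exponent_le (by linarith) (by linarith)
              _ ≤ (2 : ℝ) ^ (-(1 / 2) : ℝ) :=
                  rpow_le_rpow_of_nonpos (by norm_num) hp2 (by norm_num)
              _ ≤ 3 / 4 := by
                  rw [rpow_neg (by norm_num), ← sqrt_eq_rpow]
                  rw [inv_le_comm₀ (by positivity) (by norm_num)]
                  exact le_sqrt_of_sq_le (by norm_num)
          have h1 : (1 - t)⁻¹ ≤ 1 + 4 * t := by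
            rw [inv_le_iff_one_le_mul₀ (by linarith)]
            nlinarith
          linarith [add_one_le_exp (4 * t)]
    _ = exp (4 * ∑ p ∈ N.primesBelow, (p : ℝ) ^ (-σ)) := by
        rw [Finset.mul_sum, exp_sum]

lemma sum_primesBelow_rpow_neg_le {s : ℝ} (hs : 1 < s) (N : ℕ) :
    ∑ p ∈ N.primesBelow, (p : ℝ) ^ (-s) ≤ log (∑' n : ℕ, 1 / (n : ℝ) ^ s) := by
  have hsum := hasSum_smoothNumbers_rpow_neg (by linarith : 0 < s) N
  have hS : Summable fun n : ℕ => 1 / (n : ℝ) ^ s := summable_one_div_nat_rpow.2 hs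
  have hS' : Summable fun n : ℕ => (n : ℝ) ^ (-s) := by
    simpa [rpow_neg] using hS
  have h1 : exp (∑ p ∈ N.primesBelow, (p : ℝ) ^ (-s)) ≤ ∑' n : ℕ, 1 / (n : ℝ) ^ s := by
    rw [exp_sum]
    calc ∏ p ∈ N.primesBelow, exp ((p : ℝ) ^ (-s))
        ≤ ∏ p ∈ N.primesBelow, (1 - (p : ℝ) ^ (-s))⁻¹ := by
          refine Finset.prod_le_prod (fun p hp => (exp_pos _).le) fun p hp => ?_
          have hp' := Nat.prime_of_mem_primesBelow hp
          have hlt : (p : ℝ) ^ (-s) < 1 :=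
            rpow_lt_one_of_one_lt_of_neg (by exact_mod_cast hp'.one_lt) (by linarith)
          rw [le_inv_comm₀ (exp_pos _) (by linarith), ← exp_neg]
          linarith [add_one_le_exp (-(p : ℝ) ^ (-s))]
      _ = ∑' m : N.smoothNumbers, ((m : ℕ) : ℝ) ^ (-s) := hsum.tsum_eq.symm
      _ ≤ ∑' n : ℕ, (n : ℝ) ^ (-s) :=
          hS'.tsum_subtype_le _ _ fun n => by positivity
      _ = ∑' n : ℕ, 1 / (n : ℝ) ^ s := by simp [rpow_neg]
  exact (le_log_iff_exp_le ((exp_pos _).trans_le h1)).2 h1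

lemma eventually_sum_primesBelow_inv_le :
    ∀ᶠ x : ℝ in atTop, ∑ p ∈ (⌊x⌋₊ + 1).primesBelow, (p : ℝ)⁻¹ ≤ 3 * log (2 * log x) := by
  have ht : Tendsto (fun x : ℝ => 1 + (log x)⁻¹) atTop (nhdsWithin 1 (Set.Ioi 1)) := by
    refine tendsto_nhdsWithin_iff.2 ⟨?_, ?_⟩
    · simpa using (tendsto_inv_atTop_zero.comp tendsto_log_atTop).const_add 1
    · filter_upwards [eventually_gt_atTop 1] with x hx
      have := log_pos hx
      simpa using this
  have h2 := (tendsto_sub_mul_tsum_nat_rpow.comp ht).eventually_le_const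
    (show (1 : ℝ) < 2 by norm_num)
  filter_upwards [h2, eventually_gt_atTop (exp 1)] with x hx hx1
  have hl : 1 < log x := by rwa [lt_log_iff_exp_lt ((exp_pos 1).trans hx1)]
  have hx0 : 0 < x := (exp_pos 1).trans hx1
  set s := 1 + (log x)⁻¹ with hs
  have hs1 : 1 < s := lt_add_of_pos_right 1 (by positivity)
  simp only [Function.comp_apply, ← hs] at hx
  have hz : ∑' n : ℕ, 1 / (n : ℝ) ^ s ≤ 2 * log x := by
    have e : s - 1 = (log x)⁻¹ := by rw [hs]; ring
    rw [e, inv_mul_le_iff₀ (by linarith)] at hx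
    linarith
  have hz1 : 1 ≤ ∑' n : ℕ, 1 / (n : ℝ) ^ s := by
    have := (summable_one_div_nat_rpow.2 hs1).le_tsum 1 (fun j _ => by positivity)
    simpa using this
  calc ∑ p ∈ (⌊x⌋₊ + 1).primesBelow, (p : ℝ)⁻¹
      ≤ ∑ p ∈ (⌊x⌋₊ + 1).primesBelow, 3 * (p : ℝ) ^ (-s) := by
        refine Finset.sum_le_sum fun p hp => ?_
        have hp' := Nat.prime_of_mem_primesBelow hp
        have hp0 : (0 : ℝ) < p := by exact_mod_cast hp'.pos
        have hpx : (p : ℝ) ≤ x := by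
          have := Nat.lt_of_mem_primesBelow hp
          exact (Nat.le_floor_iff hx0.le).1 (by omega)
        have h3 : (p : ℝ) ^ (log x)⁻¹ ≤ 3 := by
          rw [rpow_def_of_pos hp0]
          have : log p * (log x)⁻¹ ≤ 1 := by
            rw [← div_eq_mul_inv, div_le_one (by linarith)]
            exact log_le_log hp0 hpx
          exact (exp_le_exp.2 this).trans exp_one_lt_three.le
        calc (p : ℝ)⁻¹ = (p : ℝ) ^ (log x)⁻¹ * (p : ℝ) ^ (-s) := by
              rw [← rpow_add hp0, ← rpow_neg_one]; congr 1; rw [hs]; ring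
          _ ≤ 3 * (p : ℝ) ^ (-s) := by gcongr
    _ = 3 * ∑ p ∈ (⌊x⌋₊ + 1).primesBelow, (p : ℝ) ^ (-s) := by rw [Finset.mul_sum]
    _ ≤ 3 * log (2 * log x) := by
        gcongr
        exact (sum_primesBelow_rpow_neg_le hs1 _).trans (log_le_log (by linarith) hz)

lemma ProductIsPerfectPower.exists_prime_le {x : ℝ} {w : ℕ} (h : ProductIsPerfectPower x w) :
    ∃ P : ℕ, P.Prime ∧ (P : ℝ) ≤ x ∧ ∀ σ : ℝ, 1 / 2 ≤ σ →
      (w : ℝ) ≤ 2 * log x * ((x / P) ^ σ *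
        exp (4 * ∑ p ∈ (P + 1).primesBelow, (p : ℝ) ^ (-σ))) := by
  obtain ⟨hw, m, hm, y, hy, n, hmono, hpos, hle, hprod⟩ := h
  have hne : y.primeFactors.Nonempty := Nat.nonempty_primeFactors.2 (by omega)
  obtain ⟨P, hPmem, hPmax⟩ := y.primeFactors.exists_max_image id hne
  have hP : P.Prime := Nat.prime_of_mem_primeFactors hPmem
  have hPy : P ∣ y := Nat.dvd_of_mem_primeFactors hPmem
  have hP0 : (0 : ℝ) < P := by exact_mod_cast hP.pos
  have hdvd : ∀ i, n i ∣ y ^ w := fun i => hprod ▸ Finset.dvd_prod_of_mem n (Finset.mem_univ i)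
  have hPx : (P : ℝ) ≤ x := by
    have : P ∣ ∏ i, n i := hprod ▸ dvd_pow hPy (by omega)
    obtain ⟨i, -, hi⟩ := hP.prime.exists_mem_finset_dvd this
    exact le_trans (by exact_mod_cast Nat.le_of_dvd (hpos i) hi) (hle i)
  have hx0 : 0 < x := hP0.trans_le hPx
  refine ⟨P, hP, hPx, fun σ hσ => ?_⟩
  set I := Finset.univ.filter fun i => P ∣ n i with hI
  have hfac : w ≤ ∑ i ∈ I, (n i).factorization P := by
    have h1 : (y ^ w).factorization P = ∑ i, (n i).factorization P := by
      rw [← hprod, Nat.factorization_prod fun i _ => (Nat.pos_iff_ne_zero.1 (hpos i))]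
      simp
    have h2 : ∑ i ∈ I, (n i).factorization P = ∑ i, (n i).factorization P := by
      refine Finset.sum_filter_of_ne fun i _ hi => ?_
      by_contra hc
      exact hi (Nat.factorization_eq_zero_of_not_dvd hc)
    rw [h2, ← h1, Nat.factorization_pow]
    have : 1 ≤ y.factorization P := hP.factorization_pos_of_dvd (by omega) hPy
    simpa using Nat.le_mul_of_pos_right w this
  have hval : ∀ i, ((n i).factorization P : ℝ) ≤ 2 * log x := by
    intro i
    have hni : (0 : ℝ) < n i := by exact_mod_cast hpos i
    have h1 : 2 ^ (n i).factorization P ≤ n i :=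
      (Nat.pow_le_pow_left hP.two_le _).trans (Nat.ordProj_le P (Nat.pos_iff_ne_zero.1 (hpos i)))
    have h2 : ((2 : ℝ) ^ (n i).factorization P) ≤ x :=
      le_trans (by exact_mod_cast h1) (hle i)
    have h3 := log_le_log (by positivity) h2
    rw [log_pow] at h3
    nlinarith [log_two_gt_d9, (Nat.cast_nonneg ((n i).factorization P) : (0 : ℝ) ≤ _)]
  have hlogx : 0 ≤ log x := log_nonneg ((by exact_mod_cast hP.one_le : (1 : ℝ) ≤ P).trans hPx)
  have hinj : Set.InjOn (fun i => n i / P) (I : Set (Fin m)) := by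
    intro i hi j hj hij
    have hi' : P ∣ n i := (Finset.mem_filter.1 hi).2
    have hj' : P ∣ n j := (Finset.mem_filter.1 hj).2
    exact hmono.injective (Nat.div_left_inj hi' hj' |>.1 hij)
  have hsmooth : ∀ k ∈ I.image (fun i => n i / P), k ∈ (P + 1).smoothNumbers := by
    intro k hk
    obtain ⟨i, hi, rfl⟩ := Finset.mem_image.1 hk
    have hi' : P ∣ n i := (Finset.mem_filter.1 hi).2
    refine Nat.mem_smoothNumbers'.2 fun p hp hpk => ?_
    have hpy : p ∣ y :=
      hp.dvd_of_dvd_pow ((hpk.trans (Nat.div_dvd_of_dvd hi')).trans (hdvd i))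
    exact Nat.lt_succ_of_le (hPmax p (Nat.mem_primeFactors.2 ⟨hp, hpy, by omega⟩))
  calc (w : ℝ) ≤ ∑ i ∈ I, ((n i).factorization P : ℝ) := by exact_mod_cast hfac
    _ ≤ ∑ i ∈ I, 2 * log x * ((x / P) ^ σ * ((n i / P : ℕ) : ℝ) ^ (-σ)) := by
        refine Finset.sum_le_sum fun i hi => (hval i).trans ?_
        have hi' : P ∣ n i := (Finset.mem_filter.1 hi).2
        have hni : (0 : ℝ) < n i := by exact_mod_cast hpos i
        refine le_mul_of_one_le_right (by positivity) ?_
        rw [Nat.cast_div hi' hP0.ne', rpow_neg (by positivity), ← div_eq_mul_inv,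
          ← div_rpow (by positivity) (by positivity), div_div_div_cancel_right₀ hP0.ne']
        exact one_le_rpow ((one_le_div hni).2 (hle i)) (by linarith)
    _ = 2 * log x * ((x / P) ^ σ * ∑ k ∈ I.image (fun i => n i / P), (k : ℝ) ^ (-σ)) := by
        rw [Finset.sum_image hinj, Finset.mul_sum, Finset.mul_sum]
    _ ≤ _ := by
        gcongr
        exact sum_smoothNumbers_rpow_neg_le hσ (P + 1) hsmooth

lemma ProductIsPerfectPower.log_le {x a : ℝ} {w : ℕ} (h : ProductIsPerfectPower x w)
    (ha0 : 0 ≤ a) (ha : a ≤ 1 / 2) (hx : 1 ≤ log (log x)) (hlx : 1 ≤ log x)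
    (hS : ∑ p ∈ (⌊x⌋₊ + 1).primesBelow, (p : ℝ)⁻¹ ≤ 3 * log (2 * log x)) :
    log w ≤ log x - 2 * √a * √(log x * log (log x)) +
      (2 * log (log x) + 13 * (log x) ^ a * log (2 * log x)) := by
  obtain ⟨P, hP, hPx, hw⟩ := h.exists_prime_le
  have hP0 : (0 : ℝ) < P := by exact_mod_cast hP.pos
  have hx0 : 0 < x := hP0.trans_le hPx
  have hw1 : (1 : ℝ) ≤ w := by exact_mod_cast h.1
  have hlP : 0 ≤ log (P : ℝ) := log_nonneg (by exact_mod_cast hP.one_le)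
  set l := log x with hl
  set v := log l with hv
  set D := max (log (P : ℝ)) v with hD
  have hDv : v ≤ D := le_max_right _ _
  have hDP : log (P : ℝ) ≤ D := le_max_left _ _
  have hD0 : 0 < D := by linarith
  set η := a * v / D with hη
  have hη0 : 0 ≤ η := by positivity
  have hηD : η * D = a * v := by rw [hη]; field_simp
  have hη1 : η ≤ 1 / 2 := by
    rw [hη, div_le_iff₀ hD0]; nlinarith
  have hηP : η * log P ≤ a * v := by rw [← hηD]; gcongr
  have hla : l ^ a = exp (a * v) := by rw [rpow_def_of_pos (by linarith), mul_comm]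
  have hla1 : 1 ≤ l ^ a := one_le_rpow hlx ha0
  have h2l : 0 ≤ log (2 * l) := log_nonneg (by linarith)
  have hsum : ∑ p ∈ (P + 1).primesBelow, (p : ℝ) ^ (-(1 - η)) ≤ l ^ a * (3 * log (2 * l)) := by
    calc ∑ p ∈ (P + 1).primesBelow, (p : ℝ) ^ (-(1 - η))
        ≤ ∑ p ∈ (P + 1).primesBelow, l ^ a * (p : ℝ)⁻¹ := by
          refine Finset.sum_le_sum fun p hp => ?_
          have hp' := Nat.prime_of_mem_primesBelow hp
          have hp0 : (0 : ℝ) < p := by exact_mod_cast hp'.pos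
          have hpP : (p : ℝ) ≤ P := by
            have := Nat.lt_of_mem_primesBelow hp
            exact_mod_cast Nat.lt_succ_iff.1 this
          rw [show -(1 - η) = η + -1 by ring, rpow_add hp0, rpow_neg_one]
          gcongr
          rw [hla, rpow_def_of_pos hp0, exp_le_exp]
          calc log p * η ≤ log P * η := by gcongr
            _ ≤ a * v := by linarith
      _ = l ^ a * ∑ p ∈ (P + 1).primesBelow, (p : ℝ)⁻¹ := by rw [Finset.mul_sum]
      _ ≤ l ^ a * ∑ p ∈ (⌊x⌋₊ + 1).primesBelow, (p : ℝ)⁻¹ := by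
          gcongr
          intro p hp
          rw [Nat.mem_primesBelow] at hp ⊢
          have := Nat.le_floor hPx
          exact ⟨by omega, hp.2⟩
      _ ≤ l ^ a * (3 * log (2 * l)) := by gcongr
  have h1 := log_le_log (by linarith) (hw (1 - η) (by linarith))
  rw [log_mul (by positivity) (by positivity), log_mul (y := exp _) (by positivity) (by positivity),
    log_exp, log_rpow (by positivity), log_div hx0.ne' hP0.ne', ← hl] at h1
  have hDle : D ≤ log P + v := max_le (by linarith) (by linarith)
  have hamgm : 2 * √a * √(l * v) ≤ D + η * l := by
    have e1 : √a * √(l * v) = √D * √(η * l) := by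
      rw [← sqrt_mul ha0, ← sqrt_mul hD0.le]
      congr 1
      linear_combination (-l) * hηD
    have e2 := two_mul_le_add_sq (√D) (√(η * l))
    rw [sq_sqrt hD0.le, sq_sqrt (by positivity)] at e2
    linarith
  have hav : a * v ≤ v := by nlinarith
  have h3 := mul_le_mul_of_nonneg_right hla1 h2l
  linarith

lemma eventually_log_le_mul_sqrt_mul_log {δ : ℝ} (hδ : 0 < δ) :
    ∀ᶠ l : ℝ in atTop, 1 ≤ δ * log l ∧ log l ≤ δ * √(l * log l) ∧ 1 ≤ δ * √(l * log l) := by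
  have h1 : ∀ᶠ l : ℝ in atTop, 1 ≤ δ * log l :=
    (tendsto_log_atTop.const_mul_atTop hδ).eventually_ge_atTop 1
  have h2 : ∀ᶠ l : ℝ in atTop, 1 ≤ log l := tendsto_log_atTop.eventually_ge_atTop 1
  have h3 := (isLittleO_log_rpow_atTop (show (0 : ℝ) < 1 / 2 by norm_num)).bound hδ
  filter_upwards [h1, h2, h3, eventually_ge_atTop 1] with l h1 h2 h3 hl
  have h4 : l ^ (1 / 2 : ℝ) ≤ √(l * log l) := by
    rw [← sqrt_eq_rpow]
    exact sqrt_le_sqrt (by nlinarith)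
  rw [norm_of_nonneg (by linarith), norm_of_nonneg (by positivity)] at h3
  have h5 : log l ≤ δ * √(l * log l) := h3.trans (by gcongr)
  exact ⟨h1, h5, h2.trans h5⟩

lemma eventually_le_mul_sqrt_mul_log {a δ : ℝ} (ha : a < 1 / 2) (hδ : 0 < δ) :
    ∀ᶠ l : ℝ in atTop,
      2 * log l + 13 * l ^ a * log (2 * l) ≤ δ * √(l * log l) := by
  have h2 : ∀ᶠ l : ℝ in atTop, 1 ≤ log l := tendsto_log_atTop.eventually_ge_atTop 1
  have h3 := (isLittleO_log_rpow_atTop (show 0 < 1 / 2 - a by linarith)).bound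
    (show 0 < δ / 52 by positivity)
  filter_upwards [h2, h3, eventually_ge_atTop 1,
    eventually_log_le_mul_sqrt_mul_log (show 0 < δ / 4 by positivity)] with l h2 h3 hl h6
  have h4 : l ^ (1 / 2 : ℝ) ≤ √(l * log l) := by
    rw [← sqrt_eq_rpow]
    exact sqrt_le_sqrt (by nlinarith)
  rw [norm_of_nonneg (by linarith), norm_of_nonneg (by positivity)] at h3
  have h7 : log (2 * l) ≤ 2 * log l := by
    rw [log_mul (by norm_num) (by positivity)]
    linarith [log_two_lt_d9]
  have h8 : l ^ a * log l ≤ δ / 52 * √(l * log l) := by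
    calc l ^ a * log l ≤ l ^ a * (δ / 52 * l ^ (1 / 2 - a)) := by gcongr
      _ = δ / 52 * l ^ (1 / 2 : ℝ) := by
        rw [mul_left_comm, ← rpow_add (by positivity)]; ring_nf
      _ ≤ _ := by gcongr
  have h9 : l ^ a * log (2 * l) ≤ l ^ a * (2 * log l) := by gcongr
  linarith [h6.2.1]

lemma eventually_lt_log_sub_log_div {W : ℝ → ℕ}
    (hW : ∀ᶠ x in atTop, ProductIsPerfectPower x (W x)) {c : ℝ} (hc : c < √2) :
    ∀ᶠ x in atTop, c < (log x - log (W x)) / √(log x * log (log x)) := by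
  have ht : Tendsto (fun a : ℝ => 2 * √a) (nhdsWithin (1 / 2) (Set.Iio (1 / 2))) (nhds √2) := by
    have h1 : ContinuousAt (fun a : ℝ => 2 * √a) (1 / 2) := by fun_prop
    have h2 : 2 * √(1 / 2 : ℝ) = √2 := by
      rw [show (1 / 2 : ℝ) = 2 / 2 ^ 2 by norm_num, sqrt_div (by norm_num),
        sqrt_sq (by norm_num)]
      ring
    rw [← h2]
    exact h1.tendsto.mono_left nhdsWithin_le_nhds
  obtain ⟨a, hca, ha0, ha⟩ := ((ht.eventually_const_lt hc).and
    (Ioo_mem_nhdsLT (show (0 : ℝ) < 1 / 2 by norm_num))).exists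
  have hδ : 0 < (2 * √a - c) / 2 := by linarith
  have hl := tendsto_log_atTop
  have hll := tendsto_log_atTop.comp tendsto_log_atTop
  filter_upwards [hW, eventually_sum_primesBelow_inv_le, hl.eventually_ge_atTop 1,
    hll.eventually_ge_atTop 1, hl.eventually (eventually_le_mul_sqrt_mul_log ha hδ)]
    with x hx hS hlx hllx hE
  have hllx' : 1 ≤ log (log x) := hllx
  have hL : 0 < √(log x * log (log x)) := by positivity
  have := hx.log_le ha0.le ha.le hllx' hlx hS
  rw [lt_div_iff₀ hL]
  nlinarith

lemma eventually_exists_productIsPerfectPower {c : ℝ} (hc : √2 < c) :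
    ∀ᶠ x in atTop, ∃ w, ProductIsPerfectPower x w ∧
      (log x - log w) / √(log x * log (log x)) < c := by
  set r := √(2 : ℝ) with hr
  have hr0 : 0 < r := by positivity
  have hrr : r * r = 2 := mul_self_sqrt (by norm_num)
  have hr2 : r < 1.5 := by nlinarith
  have hr1 : 1.4 < r := by nlinarith
  have ht : Tendsto (fun b : ℝ => r / 2 + b * r) (nhdsWithin (1 / 2) (Set.Ioi (1 / 2)))
      (nhds r) := by
    have h1 : ContinuousAt (fun b : ℝ => r / 2 + b * r) (1 / 2) := by fun_prop
    have h2 : r / 2 + 1 / 2 * r = r := by ring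
    have h3 := h1.tendsto.mono_left (nhdsWithin_le_nhds (s := Set.Ioi (1 / 2)))
    rwa [h2] at h3
  obtain ⟨b, hcb, hb, hb1⟩ := ((ht.eventually_lt_const hc).and
    (Ioo_mem_nhdsGT (show (1 / 2 : ℝ) < 1 by norm_num))).exists
  obtain ⟨δ, hδ0, hδ1, hδc⟩ : ∃ δ : ℝ, 0 < δ ∧ δ ≤ 1 / 100 ∧
      r / 2 + b * r + 16 * δ < c := by
    refine ⟨min (1 / 100) ((c - (r / 2 + b * r)) / 17), lt_min (by norm_num) (by linarith),
      min_le_left _ _, ?_⟩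
    linarith [min_le_right (1 / 100) ((c - (r / 2 + b * r)) / 17)]
  have hG := (isLittleO_log_rpow_atTop (show 0 < 2 * b - 1 by linarith)).bound
    (show (0 : ℝ) < 1 / 16 by norm_num)
  filter_upwards [tendsto_log_atTop.eventually (eventually_log_le_mul_sqrt_mul_log hδ0),
    tendsto_log_atTop.eventually hG, tendsto_log_atTop.eventually_ge_atTop 1,
    eventually_gt_atTop 0] with x hE hG hlx hx0
  set l := log x with hl
  set v := log l with hv
  set L := √(l * v) with hL
  obtain ⟨hδv, hvL, hδL⟩ := hE
  have hv1 : 1 ≤ v := by nlinarith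
  have hLL : L * L = l * v := mul_self_sqrt (by positivity)
  have hL0 : 0 < L := by positivity
  set u := r * L / v with hu
  have huv : u * v = r * L := by rw [hu]; field_simp
  have hu0 : 0 < u := by positivity
  have huL : u ≤ r * δ * L := by
    calc u = u * 1 := (mul_one u).symm
      _ ≤ u * (δ * v) := by gcongr
      _ = r * δ * L := by linear_combination δ * huv
  have hlu : l = u * (r / 2 * L) := by
    have : v * l = v * (u * (r / 2 * L)) := by
      linear_combination -hLL - (r / 2 * L) * huv - L * L / 2 * hrr
    exact mul_left_cancel₀ (by linarith) this
  have hJ : u ≤ ⌈u⌉₊ := Nat.le_ceil u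
  have hJ' : (⌈u⌉₊ : ℝ) ≤ u + 1 := (Nat.ceil_lt_add_one hu0.le).le
  set J := ⌈u⌉₊ with hJdef
  have hJ1 : 1 ≤ J := Nat.ceil_pos.2 hu0
  have hJ1' : (1 : ℝ) ≤ J := by exact_mod_cast hJ1
  have hlJ : l / J ≤ r / 2 * L := by
    rw [div_le_iff₀ (by positivity)]
    calc l = r / 2 * L * u := by rw [mul_comm]; exact hlu
      _ ≤ r / 2 * L * J := by gcongr
  have hlG : log (l ^ b) = b * v := log_rpow (by linarith) b
  have h4L : 4 * L ≤ l ^ b := by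
    rw [norm_of_nonneg (by linarith), norm_of_nonneg (by positivity)] at hG
    refine abs_le_of_sq_le_sq' ?_ (by positivity) |>.2
    have e : (l ^ b) ^ 2 = l * l ^ (2 * b - 1) := by
      rw [← rpow_natCast, ← rpow_mul (by linarith), ← rpow_one_add' (by linarith) (by linarith)]
      congr 1
      push_cast
      ring
    rw [e]
    nlinarith
  have hδL' : δ * L ≤ 1 / 100 * L := by gcongr
  have hrδ : r * δ * L ≤ 1.5 * δ * L := by gcongr
  have hu1 : 1 ≤ u := by
    have h1 : r * L ≤ u * (δ * L) := huv ▸ mul_le_mul_of_nonneg_left hvL hu0.le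
    have h2 : u * (δ * L) ≤ u * (1 / 100 * L) := by gcongr
    have h3 : r * L ≤ u / 100 * L := by linarith
    have h4 := le_of_mul_le_mul_right h3 hL0
    linarith
  have hbv : b * v ≤ v := mul_le_of_le_one_left (by linarith) hb1.le
  have hrL : r * L ≤ 1.5 * L := by gcongr
  have hrL' : 1.4 * L ≤ r * L := by gcongr
  obtain ⟨w, hw, hwl⟩ := exists_productIsPerfectPower_le_log hx0 hJ1 (G := l ^ b)
    (one_le_rpow hlx (by linarith)) (by linarith) (by
      rw [hlG, ← hl, le_div_iff₀ (by positivity)]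
      calc (5 + b * v + J) * J ≤ (r / 4 * L) * (2 * u) := by
            gcongr <;> linarith
        _ = l := by rw [hlu]; ring)
  refine ⟨w, hw, ?_⟩
  rw [div_lt_iff₀ hL0]
  rw [hlG, ← hl] at hwl
  have h5 : J * (b * v + 6) ≤ (u + 1) * (b * v + 6) := by gcongr
  have h6 : (u + 1) * (b * v + 6) = b * (r * L) + 6 * u + b * v + 6 := by
    linear_combination b * huv
  have h7 : (r / 2 + b * r + 16 * δ) * L < c * L := by gcongr
  linarith

/-- If `W x` is, for every `x ≥ 3`, the largest integer `w ≥ 1` such that some product of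
distinct integers in `[1, x]` is a perfect `w`-th power, then
`(log x - log (W x)) / √(log x · log log x) → √2` as `x → ∞`. -/
theorem log_sub_log_w_div_sqrt_tendsto_sqrt_two
    (W : ℝ → ℕ)
    (hW : ∀ x : ℝ, 3 ≤ x → IsGreatest {w : ℕ | ProductIsPerfectPower x w} (W x)) :
    Tendsto (fun x : ℝ =>
        (Real.log x - Real.log (W x)) / Real.sqrt (Real.log x * Real.log (Real.log x)))
      atTop (nhds (Real.sqrt 2)) := by
  refine tendsto_order.2 ⟨fun c hc => eventually_lt_log_sub_log_div ?_ hc, fun c hc => ?_⟩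
  · filter_upwards [eventually_ge_atTop 3] with x hx using (hW x hx).1
  · filter_upwards [eventually_ge_atTop 3, eventually_exists_productIsPerfectPower hc]
      with x hx hw
    obtain ⟨w, hw, hlt⟩ := hw
    refine lt_of_le_of_lt ?_ hlt
    have hw1 : (1 : ℝ) ≤ w := by exact_mod_cast hw.1
    have hle : (w : ℝ) ≤ W x := by exact_mod_cast (hW x hx).2 hw
    gcongr
end

section
/- For every ε > 0 there exists x₀ ≥ 3 such that for all x ≥ x₀, w(x) ≤ x·exp(−(√2 − ε)·√(log x · log log x)). -/
open Real

theorem card_le_rpow_mul_prod_primesBelow {T : Finset ℕ} {N : ℕ} {z σ : ℝ} (hz0 : 0 ≤ z)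
    (hσ : 0 < σ) (hT : ∀ m ∈ T, m ∈ N.smoothNumbers) (hz : ∀ m ∈ T, (m : ℝ) ≤ z) :
    (T.card : ℝ) ≤ z ^ σ * ∏ q ∈ N.primesBelow, (1 - (q : ℝ) ^ (-σ))⁻¹ := by
  let f : ℕ →* ℝ :=
    { toFun := fun n ↦ (n : ℝ) ^ (-σ)
      map_one' := by simp
      map_mul' := fun a b ↦ by
        push_cast
        exact mul_rpow (Nat.cast_nonneg a) (Nat.cast_nonneg b) }
  have hf : ∀ n, 0 ≤ f n := fun n ↦ rpow_nonneg (Nat.cast_nonneg n) _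
  have hlt : ∀ {p : ℕ}, p.Prime → ‖f p‖ < 1 := fun {p} hp ↦ by
    rw [Real.norm_of_nonneg (hf p)]
    exact rpow_lt_one_of_one_lt_of_neg (by exact_mod_cast hp.one_lt) (by linarith)
  have hsum := (EulerProduct.summable_and_hasSum_smoothNumbers_prod_primesBelow_geometric
    hlt N).2
  have hle : ∑ m ∈ T, f m ≤ ∏ q ∈ N.primesBelow, (1 - (q : ℝ) ^ (-σ))⁻¹ := by
    have h := sum_le_hasSum (T.subtype (· ∈ N.smoothNumbers)) (fun m _ ↦ hf m) hsum
    rwa [Finset.sum_subtype_of_mem f hT] at h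
  calc (T.card : ℝ) = ∑ m ∈ T, (1 : ℝ) := by simp
    _ ≤ ∑ m ∈ T, z ^ σ * f m := by
        refine Finset.sum_le_sum fun m hm ↦ ?_
        have hm0 : (0 : ℝ) < m :=
          Nat.cast_pos.2 (Nat.pos_of_ne_zero (Nat.ne_zero_of_mem_smoothNumbers (hT m hm)))
        change 1 ≤ z ^ σ * (m : ℝ) ^ (-σ)
        rw [rpow_neg hm0.le, ← div_eq_mul_inv, one_le_div (rpow_pos_of_pos hm0 _)]
        exact rpow_le_rpow hm0.le (hz m hm) hσ.le
    _ = z ^ σ * ∑ m ∈ T, f m := by rw [Finset.mul_sum]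
    _ ≤ _ := by gcongr

theorem prod_primesBelow_inv_le_exp {N : ℕ} {σ : ℝ} (hσ : 1 / 2 ≤ σ) :
    ∏ q ∈ N.primesBelow, (1 - (q : ℝ) ^ (-σ))⁻¹ ≤
      exp (4 * ∑ q ∈ N.primesBelow, (q : ℝ) ^ (-σ)) := by
  rw [Finset.mul_sum, exp_sum]
  have key : ∀ q ∈ N.primesBelow, 0 ≤ (q : ℝ) ^ (-σ) ∧ (q : ℝ) ^ (-σ) ≤ 3 / 4 := by
    intro q hq
    have hq2 : (2 : ℝ) ≤ q := by exact_mod_cast (Nat.prime_of_mem_primesBelow hq).two_le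
    refine ⟨by positivity, ?_⟩
    calc (q : ℝ) ^ (-σ) ≤ (q : ℝ) ^ (-(1 / 2) : ℝ) :=
          rpow_le_rpow_of_exponent_le (by linarith) (by linarith)
      _ ≤ (2 : ℝ) ^ (-(1 / 2) : ℝ) :=
          rpow_le_rpow_of_nonpos (by norm_num) hq2 (by norm_num)
      _ ≤ 3 / 4 := by
          rw [rpow_neg (by norm_num), ← sqrt_eq_rpow]
          apply inv_le_of_inv_le₀ (by norm_num)
          apply le_sqrt_of_sq_le
          norm_num
  refine Finset.prod_le_prod (fun q hq ↦ ?_) fun q hq ↦ ?_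
  · have := key q hq
    exact inv_nonneg.2 (by linarith)
  · obtain ⟨h0, h1⟩ := key q hq
    set t := (q : ℝ) ^ (-σ)
    refine le_trans ?_ (add_one_le_exp (4 * t))
    rw [inv_le_iff_one_le_mul₀ (by linarith)]
    nlinarith

theorem sum_inv_primesBelow_two_pow (j : ℕ) :
    ∑ q ∈ Nat.primesBelow (2 ^ (j + 1) + 1), (q : ℝ)⁻¹ ≤ 1 + 4 * harmonic j := by
  induction j with
  | zero =>
    have : Nat.primesBelow (2 ^ (0 + 1) + 1) = {2} := by decide
    rw [this]
    norm_num
  | succ j ih =>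
    have hsub : Nat.primesBelow (2 ^ (j + 1) + 1) ⊆ Nat.primesBelow (2 ^ (j + 2) + 1) := by
      intro q hq
      rw [Nat.mem_primesBelow] at hq ⊢
      exact ⟨hq.1.trans_le (by gcongr <;> omega), hq.2⟩
    rw [← Finset.sum_sdiff hsub, harmonic_succ]
    set B := Nat.primesBelow (2 ^ (j + 2) + 1) \ Nat.primesBelow (2 ^ (j + 1) + 1) with hB
    have hmem : ∀ q ∈ B, q.Prime ∧ 2 ^ (j + 1) < q ∧ q ≤ 2 ^ (j + 2) := by
      intro q hq
      simp only [hB, Finset.mem_sdiff, Nat.mem_primesBelow] at hq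
      refine ⟨hq.1.2, ?_, by omega⟩
      by_contra! h
      exact hq.2 ⟨by omega, hq.1.2⟩
    have hcard : (B.card : ℝ) * ((j + 1) * log 2) ≤ log 4 * 2 ^ (j + 2) := by
      calc (B.card : ℝ) * ((j + 1) * log 2) = ∑ q ∈ B, ((j + 1) * log 2) := by simp
        _ ≤ ∑ q ∈ B, log q := by
            refine Finset.sum_le_sum fun q hq ↦ ?_
            have h : ((2 : ℝ) ^ (j + 1)) ≤ q := by exact_mod_cast (hmem q hq).2.1.le
            calc ((j : ℝ) + 1) * log 2 = log (2 ^ (j + 1)) := by rw [log_pow]; push_cast; ring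
              _ ≤ log q := log_le_log (by positivity) h
        _ ≤ ∑ q ∈ Nat.primesLE (2 ^ (j + 2)), log q := by
            refine Finset.sum_le_sum_of_subset_of_nonneg (fun q hq ↦ ?_) fun q _ _ ↦
              log_natCast_nonneg q
            rw [Nat.mem_primesLE]
            exact ⟨(hmem q hq).2.2, (hmem q hq).1⟩
        _ = Chebyshev.theta ((2 ^ (j + 2) : ℕ) : ℝ) :=
            (Chebyshev.theta_eq_sum_primesLE_log _).symm
        _ ≤ log 4 * 2 ^ (j + 2) := by
            simpa using Chebyshev.theta_le_log4_mul_x (x := ((2 ^ (j + 2) : ℕ) : ℝ))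
              (Nat.cast_nonneg _)
    have h4 : log 4 = 2 * log 2 := by
      rw [show (4 : ℝ) = 2 ^ 2 by norm_num, log_pow]; norm_num
    have hl2 : 0 < log 2 := log_pos (by norm_num)
    have hcard' : (B.card : ℝ) * (j + 1) ≤ 4 * 2 ^ (j + 1) := by
      rw [h4] at hcard
      refine le_of_mul_le_mul_right ?_ hl2
      calc _ = (B.card : ℝ) * ((j + 1) * log 2) := by ring
        _ ≤ _ := hcard
        _ = _ := by ring
    have hblock : ∑ q ∈ B, (q : ℝ)⁻¹ ≤ 4 * (j + 1 : ℝ)⁻¹ := by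
      calc ∑ q ∈ B, (q : ℝ)⁻¹ ≤ ∑ q ∈ B, ((2 : ℝ) ^ (j + 1))⁻¹ := by
            refine Finset.sum_le_sum fun q hq ↦ ?_
            have h : ((2 : ℝ) ^ (j + 1)) ≤ q := by exact_mod_cast (hmem q hq).2.1.le
            gcongr
        _ = B.card / (2 : ℝ) ^ (j + 1) := by simp [div_eq_mul_inv]
        _ ≤ _ := by
            rw [← div_eq_mul_inv, div_le_div_iff₀ (by positivity) (by positivity)]
            exact hcard'
    push_cast
    linarith

theorem sum_inv_primesBelow_le {x : ℝ} (hx : 3 ≤ x) {p : ℕ} (hp : (p : ℝ) ≤ x) :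
    ∑ q ∈ (p + 1).primesBelow, (q : ℝ)⁻¹ ≤ 5 + 4 * log (2 * log x) := by
  have hp' : p ≤ ⌊x⌋₊ := Nat.le_floor hp
  set N := ⌊x⌋₊
  have hN : 3 ≤ N := Nat.le_floor (by exact_mod_cast hx)
  set j := Nat.log 2 N
  have hj : j ≠ 0 := (Nat.log_pos (by norm_num) (by omega)).ne'
  have hlt : N < 2 ^ (j + 1) := Nat.lt_pow_succ_log_self (by norm_num) N
  have hpow : 2 ^ j ≤ N := Nat.pow_log_le_self 2 (by omega)
  have hjx : (j : ℝ) ≤ 2 * log x := by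
    have h1 : ((2 : ℝ) ^ j) ≤ x :=
      le_trans (by exact_mod_cast hpow) (Nat.floor_le (by linarith))
    have h2 := log_le_log (by positivity) h1
    rw [log_pow] at h2
    have := log_two_gt_d9
    have : (0 : ℝ) ≤ j := Nat.cast_nonneg j
    nlinarith
  have hj0 : (0 : ℝ) < j := by positivity
  calc ∑ q ∈ (p + 1).primesBelow, (q : ℝ)⁻¹
      ≤ ∑ q ∈ Nat.primesBelow (2 ^ (j + 1) + 1), (q : ℝ)⁻¹ := by
        refine Finset.sum_le_sum_of_subset_of_nonneg (fun q hq ↦ ?_) fun q _ _ ↦ by positivity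
        rw [Nat.mem_primesBelow] at hq ⊢
        exact ⟨by omega, hq.2⟩
    _ ≤ 1 + 4 * harmonic j := sum_inv_primesBelow_two_pow j
    _ ≤ 1 + 4 * (1 + log j) := by gcongr; exact harmonic_le_one_add_log j
    _ ≤ 1 + 4 * (1 + log (2 * log x)) := by gcongr
    _ = _ := by ring

theorem ProductIsPerfectPower.exists_prime_smooth {x : ℝ} {w : ℕ}
    (h : ProductIsPerfectPower x w) :
    ∃ p : ℕ, p.Prime ∧ (p : ℝ) ≤ x ∧ ∃ T : Finset ℕ,
      (∀ m ∈ T, m ∈ (p + 1).smoothNumbers ∧ (m : ℝ) ≤ x / p) ∧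
      (w : ℝ) ≤ 2 * log x * T.card := by
  obtain ⟨hw, m, hm, y, hy, n, hn, hn1, hnx, hprod⟩ := h
  have hne : y.primeFactors.Nonempty := Nat.nonempty_primeFactors.2 (by omega)
  set p := y.primeFactors.max' hne
  have hpy : p ∈ y.primeFactors := Finset.max'_mem _ _
  have hp : p.Prime := Nat.prime_of_mem_primeFactors hpy
  have hp0 : (0 : ℝ) < p := by exact_mod_cast hp.pos
  have hsmooth : ∀ i, n i ∈ (p + 1).smoothNumbers := by
    intro i
    rw [Nat.mem_smoothNumbers']
    intro q hq hqi
    have hqy : q ∣ y := hq.dvd_of_dvd_pow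
      (hprod ▸ hqi.trans (Finset.dvd_prod_of_mem n (Finset.mem_univ i)))
    have := Finset.le_max' _ _ (Nat.mem_primeFactors.2 ⟨hq, hqy, by omega⟩)
    omega
  have hval : w ≤ ∑ i, (n i).factorization p := by
    have h1 : (∏ i, n i).factorization p = ∑ i, (n i).factorization p := by
      rw [Nat.factorization_prod fun i _ ↦ (by have := hn1 i; omega)]
      simp
    rw [← h1, hprod, Nat.factorization_pow]
    have := hp.factorization_pos_of_dvd (by omega) (Nat.dvd_of_mem_primeFactors hpy)
    simpa using Nat.le_mul_of_pos_right w this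
  let I : Finset (Fin m) := Finset.univ.filter (p ∣ n ·)
  have hI : ∀ i ∈ I, p ∣ n i := fun i hi ↦ (Finset.mem_filter.1 hi).2
  obtain ⟨i₀, -, hi₀⟩ : ∃ i ∈ Finset.univ, p ∣ n i := by
    apply (hp.prime.dvd_finsetProd_iff n).1
    rw [hprod]
    exact dvd_pow (Nat.dvd_of_mem_primeFactors hpy) (by omega)
  refine ⟨p, hp, ?_, I.image (n · / p), ?_, ?_⟩
  · exact le_trans (by exact_mod_cast Nat.le_of_dvd (hn1 i₀) hi₀) (hnx i₀)
  · simp only [Finset.mem_image]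
    rintro _ ⟨i, hi, rfl⟩
    refine ⟨Nat.mem_smoothNumbers_of_dvd (hsmooth i) (Nat.div_dvd_of_dvd (hI i hi)), ?_⟩
    rw [Nat.cast_div (hI i hi) hp0.ne']
    gcongr
    exact hnx i
  · rw [Finset.card_image_of_injOn]
    · calc (w : ℝ) ≤ ∑ i, ((n i).factorization p : ℝ) := by exact_mod_cast hval
        _ = ∑ i ∈ I, ((n i).factorization p : ℝ) := by
            refine (Finset.sum_subset (Finset.subset_univ I) fun i _ hi ↦ ?_).symm
            have : ¬ p ∣ n i := by simpa [I] using hi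
            simp [Nat.factorization_eq_zero_of_not_dvd this]
        _ ≤ ∑ i ∈ I, 2 * log x := by
            refine Finset.sum_le_sum fun i _ ↦ ?_
            have hle : 2 ^ (n i).factorization p ≤ n i :=
              (Nat.pow_le_pow_left hp.two_le _).trans
                (Nat.ordProj_le p (by have := hn1 i; omega))
            have h1 : ((2 : ℝ) ^ (n i).factorization p) ≤ x :=
              le_trans (by exact_mod_cast hle) (hnx i)
            have h2 := log_le_log (by positivity) h1
            rw [log_pow] at h2
            have := log_two_gt_d9
            have : (0 : ℝ) ≤ (n i).factorization p := Nat.cast_nonneg _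
            nlinarith
        _ = 2 * log x * I.card := by rw [Finset.sum_const, nsmul_eq_mul, mul_comm]
    · intro a ha b hb hab
      apply hn.injective
      exact (Nat.div_left_inj (hI a ha) (hI b hb)).1 hab

theorem eventually_error_le {δ ε : ℝ} (hδ : 0 < δ) (hε : 0 < ε) :
    ∀ᶠ x in Filter.atTop, 4 * log (log x) ≤ √(log x * log (log x)) ∧
      log 2 + 2 * log (log x) + 4 * (log x ^ (1 / 2 - δ) * (5 + 4 * log (2 * log x))) ≤
        ε * √(log x * log (log x)) := by
  suffices h : ∀ᶠ t in Filter.atTop, 4 * log t ≤ √(t * log t) ∧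
      log 2 + 2 * log t + 4 * (t ^ (1 / 2 - δ) * (5 + 4 * log (2 * t))) ≤
        ε * √(t * log t) from tendsto_log_atTop.eventually h
  have h1 : (fun t : ℝ ↦ 4 * log t) =o[Filter.atTop] fun t ↦ t ^ (1 / 2 : ℝ) :=
    (isLittleO_log_rpow_atTop (by norm_num)).const_mul_left 4
  have hconst : ∀ c r : ℝ, 0 < r → (fun _ : ℝ ↦ c) =o[Filter.atTop] fun t ↦ t ^ r :=
    fun c r hr ↦ Asymptotics.isLittleO_const_left.2 <| Or.inr <|
      tendsto_norm_atTop_atTop.comp (tendsto_rpow_atTop hr)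
  have h2 : (fun t : ℝ ↦ log 2 + 2 * log t) =o[Filter.atTop] fun t ↦ t ^ (1 / 2 : ℝ) :=
    (hconst _ _ (by norm_num)).add
      ((isLittleO_log_rpow_atTop (by norm_num)).const_mul_left 2)
  have h3 : (fun t : ℝ ↦ (5 + 4 * log 2) + 4 * log t) =o[Filter.atTop] fun t ↦ t ^ δ :=
    (hconst _ _ hδ).add ((isLittleO_log_rpow_atTop hδ).const_mul_left 4)
  filter_upwards [h1.bound one_pos, h2.bound (half_pos hε),
    h3.bound (show 0 < ε / 8 by positivity), Filter.eventually_ge_atTop (exp 1)]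
    with t b1 b2 b3 ht
  have ht0 : 0 < t := (exp_pos 1).trans_le ht
  have hlog : 1 ≤ log t := by rwa [le_log_iff_exp_le ht0]
  have hpow : ∀ r : ℝ, ‖t ^ r‖ = t ^ r := fun r ↦ norm_of_nonneg (by positivity)
  rw [hpow] at b1 b2 b3
  have hsqrt : t ^ (1 / 2 : ℝ) ≤ √(t * log t) := by
    rw [← sqrt_eq_rpow]
    exact sqrt_le_sqrt (by nlinarith)
  have c1 := (le_norm_self _).trans b1
  have c2 := (le_norm_self _).trans b2
  have c3 := (le_norm_self _).trans b3
  refine ⟨by linarith, ?_⟩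
  have hsplit : t ^ (1 / 2 - δ) * t ^ δ = t ^ (1 / 2 : ℝ) := by
    rw [← rpow_add ht0]
    ring_nf
  have h4 : t ^ (1 / 2 - δ) * (5 + 4 * log (2 * t)) ≤ ε / 8 * t ^ (1 / 2 : ℝ) := by
    rw [← hsplit, log_mul (by norm_num) ht0.ne']
    calc _ ≤ t ^ (1 / 2 - δ) * (ε / 8 * t ^ δ) := by
          gcongr
          linarith
      _ = _ := by ring
  have h5 := mul_le_mul_of_nonneg_left hsqrt hε.le
  linarith

theorem sqrt_two_sub_mul_le {δ L A P : ℝ} (hL : 0 < L) (hA : A = (1 / 2 - δ) * L ^ 2)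
    (hδ : 0 < δ) (hδ' : δ ≤ 1 / 8) {ε : ℝ} (hε : 8 * δ ≤ ε) (hP : 0 < P) :
    (√2 - ε) * L ≤ P + A / max P (L / 4) := by
  have hs0 : 1 ≤ √2 := le_sqrt_of_sq_le (by norm_num)
  have hs1 : √2 ≤ 3 / 2 := sqrt_le_iff.2 (by norm_num)
  have hs2 : √2 * √2 = 2 := mul_self_sqrt (by norm_num)
  have hA0 : 0 < A := hA ▸ mul_pos (by linarith) (by positivity)
  rcases le_total P (L / 4) with h | h
  · rw [max_eq_right h]
    have h1 : A / (L / 4) = 4 * (1 / 2 - δ) * L := by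
      rw [hA]
      field_simp
    rw [h1]
    nlinarith
  · rw [max_eq_left h]
    have hsq : ((√2 - ε) * L) * P ≤ P ^ 2 + A := by
      rcases le_total (√2 - ε) 0 with hs | hs
      · have : ((√2 - ε) * L) * P ≤ 0 :=
          mul_nonpos_of_nonpos_of_nonneg (mul_nonpos_of_nonpos_of_nonneg hs hL.le) hP.le
        nlinarith
      · have h2 : (√2 - ε) ^ 2 ≤ 2 - 4 * δ := by nlinarith
        have h3 := mul_le_mul_of_nonneg_right h2 (sq_nonneg L)
        nlinarith [sq_nonneg (P - (√2 - ε) * L / 2)]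
    have h4 : P + A / P = (P ^ 2 + A) / P := by field_simp
    rwa [h4, le_div_iff₀ hP]

/-- Upper bound: for every `ε > 0` there is `x₀ ≥ 3` such that for all `x ≥ x₀`,
`w(x) ≤ x · exp(−(√2 − ε)·√(log x · log log x))`. -/
theorem w_upper_bound
    (W : ℝ → ℕ)
    (hW : ∀ x : ℝ, 3 ≤ x → IsGreatest {w : ℕ | ProductIsPerfectPower x w} (W x)) :
    ∀ ε : ℝ, 0 < ε → ∃ x₀ : ℝ, 3 ≤ x₀ ∧ ∀ x : ℝ, x₀ ≤ x →
      (W x : ℝ) ≤ x * Real.exp (-(Real.sqrt 2 - ε) *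
        Real.sqrt (Real.log x * Real.log (Real.log x))) := by
  intro ε hε
  set δ := min (ε / 16) (1 / 8)
  have hδ0 : 0 < δ := lt_min (by positivity) (by norm_num)
  have hδ8 : δ ≤ 1 / 8 := min_le_right _ _
  have hδε : 8 * δ ≤ ε / 2 := by
    have : δ ≤ ε / 16 := min_le_left _ _
    linarith
  obtain ⟨x₁, hx₁⟩ := Filter.eventually_atTop.1 (eventually_error_le hδ0 (half_pos hε))
  refine ⟨max x₁ 3, le_max_right _ _, fun x hx ↦ ?_⟩
  have hx3 : 3 ≤ x := (le_max_right _ _).trans hx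
  obtain ⟨hsmall, herr⟩ := hx₁ x ((le_max_left _ _).trans hx)
  obtain ⟨p, hp, hpx, T, hT, hw⟩ :=
    ProductIsPerfectPower.exists_prime_smooth (hW x hx3).1
  have hx0 : 0 < x := by linarith
  have hp0 : (0 : ℝ) < p := by exact_mod_cast hp.pos
  have hl : 1 < log x := by
    rw [lt_log_iff_exp_lt hx0]
    exact exp_one_lt_d9.trans (by linarith)
  have hm : 0 < log (log x) := log_pos hl
  have hP : 0 < log p := log_pos (by exact_mod_cast hp.one_lt)
  have hPx : log p ≤ log x := log_le_log hp0 hpx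
  set ℓ := log x with hℓ
  set m := log ℓ with hm_def
  set L := √(ℓ * m) with hL_def
  set P := log (p : ℝ) with hP_def
  have hL : 0 < L := sqrt_pos.2 (by positivity)
  have hL2 : L ^ 2 = ℓ * m := sq_sqrt (by positivity)
  have hM : 0 < max P (L / 4) := lt_max_of_lt_left hP
  set η := (1 / 2 - δ) * m / max P (L / 4) with hη
  have hη0 : 0 ≤ η := div_nonneg (mul_nonneg (by linarith) hm.le) hM.le
  have hη2 : η ≤ 1 / 2 := by
    rw [hη, div_le_iff₀ hM]
    have := le_max_right P (L / 4)
    nlinarith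
  have hηP : η * P ≤ (1 / 2 - δ) * m := by
    calc η * P ≤ η * max P (L / 4) := by gcongr; exact le_max_left _ _
      _ = _ := div_mul_cancel₀ _ hM.ne'
  have hmain : (√2 - ε / 2) * L ≤ P + η * ℓ := by
    have := sqrt_two_sub_mul_le hL rfl hδ0 hδ8 hδε hP
    rwa [hL2, show (1 / 2 - δ) * (ℓ * m) / max P (L / 4) = η * ℓ by rw [hη]; ring] at this
  have hsum : ∑ q ∈ (p + 1).primesBelow, (q : ℝ) ^ (-(1 - η)) ≤
      ℓ ^ (1 / 2 - δ) * (5 + 4 * log (2 * ℓ)) := by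
    calc ∑ q ∈ (p + 1).primesBelow, (q : ℝ) ^ (-(1 - η))
        ≤ ∑ q ∈ (p + 1).primesBelow, ℓ ^ (1 / 2 - δ) * (q : ℝ)⁻¹ := by
          refine Finset.sum_le_sum fun q hq ↦ ?_
          have hqp : q ≤ p := Nat.lt_succ_iff.1 (Nat.mem_primesBelow.1 hq).1
          have hq0 : (0 : ℝ) < q := by exact_mod_cast (Nat.prime_of_mem_primesBelow hq).pos
          rw [show -(1 - η) = η + -1 by ring, rpow_add hq0, rpow_neg_one]
          gcongr
          rw [rpow_def_of_pos hq0, rpow_def_of_pos (by linarith : 0 < ℓ), exp_le_exp]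
          calc log q * η ≤ P * η := by
                gcongr
                exact log_le_log hq0 (by exact_mod_cast hqp)
            _ ≤ log ℓ * (1 / 2 - δ) := by linarith
      _ = ℓ ^ (1 / 2 - δ) * ∑ q ∈ (p + 1).primesBelow, (q : ℝ)⁻¹ := by rw [Finset.mul_sum]
      _ ≤ _ := by
          gcongr
          exact sum_inv_primesBelow_le hx3 hpx
  have hcard : (T.card : ℝ) ≤ exp ((ℓ - P) * (1 - η)) *
      exp (4 * (ℓ ^ (1 / 2 - δ) * (5 + 4 * log (2 * ℓ)))) := by
    have hz : 0 < x / p := by positivity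
    calc (T.card : ℝ) ≤ (x / p) ^ (1 - η) *
          ∏ q ∈ (p + 1).primesBelow, (1 - (q : ℝ) ^ (-(1 - η)))⁻¹ :=
          card_le_rpow_mul_prod_primesBelow hz.le (by linarith) (fun m hm ↦ (hT m hm).1)
            fun m hm ↦ (hT m hm).2
      _ ≤ (x / p) ^ (1 - η) * exp (4 * ∑ q ∈ (p + 1).primesBelow, (q : ℝ) ^ (-(1 - η))) := by
          gcongr
          exact prod_primesBelow_inv_le_exp (by linarith)
      _ ≤ _ := by
          rw [rpow_def_of_pos hz, log_div hx0.ne' hp0.ne']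
          gcongr
  calc (W x : ℝ) ≤ 2 * ℓ * T.card := hw
    _ ≤ exp (log 2 + m) * (exp ((ℓ - P) * (1 - η)) *
          exp (4 * (ℓ ^ (1 / 2 - δ) * (5 + 4 * log (2 * ℓ))))) := by
        rw [exp_add, exp_log two_pos, hm_def, exp_log (by linarith : 0 < ℓ)]
        gcongr
    _ ≤ exp (ℓ + -(√2 - ε) * L) := by
        rw [← exp_add, ← exp_add, exp_le_exp]
        nlinarith
    _ = x * exp (-(√2 - ε) * L) := by rw [exp_add, hℓ, exp_log hx0]
end

section
/- For every ε > 0 there exists x₀ ≥ 3 such that for all x ≥ x₀, w(x) ≥ x·exp(−(√2 + ε)·√(log x · log log x)). -/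
open Real

open Finset MvPolynomial in
/-- Any family of more than `|κ| (q - 1)` vectors of `(ZMod q) ^ κ`, with `q` prime, has a nonempty
subfamily of sum zero. -/
theorem exists_nonempty_subset_sum_eq_zero {ι κ : Type*} (q : ℕ) [Fact q.Prime] (S : Finset ι)
    (R : Finset κ) (a : ι → κ → ZMod q) (h : #R * (q - 1) < #S) :
    ∃ T ⊆ S, T.Nonempty ∧ ∀ r ∈ R, ∑ i ∈ T, a i r = 0 := by
  classical
  have hq : q.Prime := Fact.out
  let f : κ → MvPolynomial S (ZMod q) := fun r => ∑ i : S, a i r • X i ^ (q - 1)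
  have hdeg : ∑ r ∈ R, (f r).totalDegree < Fintype.card S := by
    rw [Fintype.card_coe]
    refine lt_of_le_of_lt ?_ h
    rw [← smul_eq_mul]
    refine sum_le_card_nsmul _ _ _ fun r _ => ?_
    refine totalDegree_finsetSum_le fun i _ => ?_
    exact (totalDegree_smul_le ..).trans (totalDegree_X_pow ..).le
  let zeroSol : {x : S → ZMod q // ∀ r ∈ R, eval x (f r) = 0} :=
    ⟨0, fun r _ => by simp [f, map_sum, hq.one_lt, tsub_eq_zero_iff_le]⟩
  have hN₀ : 0 < Fintype.card {x : S → ZMod q // ∀ r ∈ R, eval x (f r) = 0} :=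
    @Fintype.card_pos _ _ ⟨zeroSol⟩
  obtain ⟨x, hx⟩ := Fintype.exists_ne_of_one_lt_card (hq.one_lt.trans_le <|
    Nat.le_of_dvd hN₀ (char_dvd_card_solutions_of_sum_lt q hdeg)) zeroSol
  refine ⟨({i | x.1 i ≠ 0} : Finset _).map ⟨(↑), Subtype.val_injective⟩, ?_, ?_, ?_⟩
  · simp +contextual [subset_iff]
  · rw [map_nonempty]
    rw [← Subtype.coe_ne_coe, Function.ne_iff] at hx
    obtain ⟨i, hi⟩ := hx
    exact ⟨i, mem_filter.2 ⟨mem_univ _, hi⟩⟩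
  · intro r hr
    simpa [f, ZMod.pow_card_sub_one, Finset.sum_filter] using x.2 r hr

theorem Nat.exists_eq_pow_of_forall_dvd_factorization {n q : ℕ} (hn : n ≠ 0)
    (h : ∀ p, q ∣ n.factorization p) : ∃ y, n = y ^ q := by
  refine ⟨∏ p ∈ n.primeFactors, p ^ (n.factorization p / q), ?_⟩
  rw [← Finset.prod_pow]
  conv_lhs => rw [← Nat.prod_factorization_pow_eq_self hn]
  refine Finset.prod_congr rfl fun p _ => ?_
  rw [← pow_mul, Nat.div_mul_cancel (h p)]

open Finset in
/-- If all prime factors of the elements of `S` lie in `R`, and `S` has more than `|R| (q - 1)`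
elements, then some nonempty subset of `S` has a perfect `q`-th power as its product. -/
theorem exists_subset_prod_eq_pow {q : ℕ} (hq : q.Prime) {S R : Finset ℕ} (hS : ∀ n ∈ S, n ≠ 0)
    (hR : ∀ n ∈ S, n.primeFactors ⊆ R) (h : #R * (q - 1) < #S) :
    ∃ T ⊆ S, T.Nonempty ∧ ∃ y, ∏ n ∈ T, n = y ^ q := by
  have : Fact q.Prime := ⟨hq⟩
  obtain ⟨T, hTS, hT, hsum⟩ := exists_nonempty_subset_sum_eq_zero q S R
    (fun n r => (n.factorization r : ZMod q)) h
  refine ⟨T, hTS, hT, Nat.exists_eq_pow_of_forall_dvd_factorization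
    (prod_ne_zero_iff.2 fun n hn => hS n (hTS hn)) fun r => ?_⟩
  rw [Nat.factorization_prod_apply fun n hn => hS n (hTS hn)]
  by_cases hr : r ∈ R
  · have := hsum r hr
    rwa [← Nat.cast_sum, ZMod.natCast_eq_zero_iff] at this
  · rw [sum_eq_zero fun n hn => ?_]
    · exact dvd_zero q
    · rw [← Finsupp.notMem_support_iff, Nat.support_factorization]
      exact fun hmem => hr (hR n (hTS hn) hmem)

open Finset in
theorem productIsPerfectPower_of_card_lt {x : ℝ} {q : ℕ} (hq : q.Prime) {S R : Finset ℕ}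
    (hS : ∀ n ∈ S, 2 ≤ n) (hSx : ∀ n ∈ S, (n : ℝ) ≤ x) (hR : ∀ n ∈ S, n.primeFactors ⊆ R)
    (h : #R * (q - 1) < #S) : ProductIsPerfectPower x q := by
  obtain ⟨T, hTS, hT, y, hy⟩ :=
    exists_subset_prod_eq_pow hq (fun n hn => by have := hS n hn; lia) hR h
  refine ⟨hq.one_le, #T, hT.card_pos, y, ?_, T.orderEmbOfFin rfl, (T.orderEmbOfFin rfl).strictMono,
    fun i => ?_, fun i => ?_, ?_⟩
  · obtain ⟨n, hn⟩ := hT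
    have hle : n ≤ ∏ n ∈ T, n :=
      Nat.le_of_dvd (prod_pos fun m hm => by have := hS m (hTS hm); lia) (dvd_prod_of_mem _ hn)
    have hn2 := hS n (hTS hn)
    by_contra! hlt
    interval_cases y
    · rw [zero_pow hq.ne_zero] at hy
      lia
    · rw [one_pow] at hy
      lia
  · have := hS _ (hTS (T.orderEmbOfFin_mem rfl i))
    lia
  · exact hSx _ (hTS (T.orderEmbOfFin_mem rfl i))
  · rw [← hy, ← prod_coe_sort T, ← (T.orderIsoOfFin rfl).toEquiv.prod_comp]
    simp [coe_orderIsoOfFin_apply]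

open Finset in
/-- If `S` is a set of `y`-smooth integers in `[2, x]` with at least `2 y` elements, then some
perfect power with exponent at least `|S| / (2 y)` is a product of distinct elements of `S`. -/
theorem exists_productIsPerfectPower {x y : ℝ} (hy : 0 < y) {S : Finset ℕ}
    (hS : ∀ n ∈ S, 2 ≤ n) (hSx : ∀ n ∈ S, (n : ℝ) ≤ x)
    (hSy : ∀ n ∈ S, ∀ p ∈ n.primeFactors, (p : ℝ) ≤ y) (h : 2 * y ≤ #S) :
    ∃ q : ℕ, #S / (2 * y) ≤ q ∧ ProductIsPerfectPower x q := by
  have hN : 2 ≤ ⌊#S / y⌋₊ := Nat.le_floor (by rw [le_div_iff₀ hy]; exact_mod_cast h)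
  obtain ⟨q, hq, hlt, hle⟩ := Nat.exists_prime_lt_and_le_two_mul (⌊#S / y⌋₊ / 2) (by lia)
  have hqN : q ≤ ⌊#S / y⌋₊ := by lia
  have hNq : ⌊#S / y⌋₊ + 1 ≤ 2 * q := by lia
  refine ⟨q, ?_, productIsPerfectPower_of_card_lt hq (R := Icc 1 ⌊y⌋₊) hS hSx ?_ ?_⟩
  · have h1 := (Nat.lt_floor_add_one (#S / y : ℝ)).le
    have h2 : ((⌊#S / y⌋₊ : ℝ) + 1) ≤ 2 * q := by exact_mod_cast hNq
    have h3 : (#S / (2 * y) : ℝ) = (#S / y) / 2 := by ring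
    rw [h3]
    linarith
  · exact fun n hn p hp => mem_Icc.2 ⟨(Nat.prime_of_mem_primeFactors hp).one_le,
      Nat.le_floor (hSy n hn p hp)⟩
  · rw [Nat.card_Icc, Nat.add_sub_cancel]
    have h1 : (q : ℝ) * y ≤ #S := by
      rw [← le_div_iff₀ hy]
      exact (Nat.cast_le.2 hqN).trans (Nat.floor_le (by positivity))
    have h2 := Nat.floor_le hy.le
    have hq1 : ((q - 1 : ℕ) : ℝ) = q - 1 := by rw [Nat.cast_sub hq.one_le, Nat.cast_one]
    have h3 : ((⌊y⌋₊ * (q - 1) : ℕ) : ℝ) < #S := by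
      rw [Nat.cast_mul, hq1]
      have h4 : (1 : ℝ) ≤ q := by exact_mod_cast hq.one_le
      nlinarith
    exact_mod_cast h3

open Filter in
theorem Chebyshev.eventually_half_mul_le_theta : ∀ᶠ t : ℝ in atTop, t / 2 ≤ Chebyshev.theta t := by
  have h0 : (fun t : ℝ => Real.log (t + 2)) =o[atTop] fun t => t := by
    have h1 : (fun t : ℝ => Real.log (t + 2)) =o[atTop] fun t => t + 2 :=
      Real.isLittleO_log_id_atTop.comp_tendsto (tendsto_atTop_add_const_right _ 2 tendsto_id)
    refine h1.trans_isBigO (Asymptotics.IsBigO.of_bound 2 ?_)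
    filter_upwards [eventually_ge_atTop 2] with t ht
    rw [Real.norm_of_nonneg (by linarith), Real.norm_of_nonneg (by linarith)]
    linarith
  have h2 : (fun t : ℝ => √t * Real.log t) =o[atTop] fun t => t := by
    have h3 := (Asymptotics.isBigO_refl (fun t : ℝ => √t) atTop).mul_isLittleO
      (isLittleO_log_rpow_atTop (show (0 : ℝ) < 1 / 2 by norm_num))
    refine h3.congr' EventuallyEq.rfl ?_
    filter_upwards [eventually_ge_atTop 0] with t ht
    rw [← Real.sqrt_eq_rpow, Real.mul_self_sqrt ht]
  filter_upwards [h0.bound (show (0 : ℝ) < 1 / 20 by norm_num),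
    h2.bound (show (0 : ℝ) < 1 / 40 by norm_num), eventually_ge_atTop 100] with t ht1 ht2 ht
  have h5 := Chebyshev.theta_ge' (x := t) (by linarith)
  rw [Real.norm_of_nonneg (by linarith : 0 ≤ t)] at ht1 ht2
  have h6 := (le_abs_self _).trans ht1
  have h7 := (le_abs_self _).trans ht2
  have h8 := Real.log_two_gt_d9
  nlinarith

theorem Chebyshev.theta_sub_theta {s t : ℝ} (hst : s ≤ t) :
    Chebyshev.theta t - Chebyshev.theta s =
      ∑ p ∈ Finset.Ioc ⌊s⌋₊ ⌊t⌋₊ with p.Prime, Real.log p := by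
  rw [sub_eq_iff_eq_add', Chebyshev.theta, Chebyshev.theta, Finset.sum_filter, Finset.sum_filter,
    Finset.sum_filter, Finset.sum_Ioc_consecutive _ (Nat.zero_le _) (Nat.floor_mono hst)]

theorem exists_forall_sum_one_div_prime_ge_of_four_mul_le : ∃ T : ℝ, ∀ z, T ≤ z → 2 ≤ z →
    ∀ y, 4 * z ≤ y →
      1 / (8 * Real.log y) ≤ ∑ p ∈ Finset.Ioc ⌊z⌋₊ ⌊y⌋₊ with p.Prime, 1 / (p : ℝ) := by
  obtain ⟨T, hT⟩ := Filter.eventually_atTop.1 Chebyshev.eventually_half_mul_le_theta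
  refine ⟨T, fun z hz hz2 y hy => ?_⟩
  have hlog : 0 < Real.log y := Real.log_pos (by linarith)
  have hterm : ∀ p ∈ (Finset.Ioc ⌊z⌋₊ ⌊4 * z⌋₊).filter Nat.Prime,
      Real.log p / (4 * z * Real.log y) ≤ 1 / (p : ℝ) := by
    intro p hp
    rw [Finset.mem_filter, Finset.mem_Ioc] at hp
    have hp0 : (0 : ℝ) < p := by exact_mod_cast hp.2.pos
    have hpz : (p : ℝ) ≤ 4 * z := (Nat.le_floor_iff (by linarith)).1 hp.1.2
    have hpy : Real.log p ≤ Real.log y := Real.log_le_log hp0 (hpz.trans hy)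
    rw [div_le_div_iff₀ (by positivity) hp0, one_mul, mul_comm]
    exact mul_le_mul hpz hpy (Real.log_nonneg (by exact_mod_cast hp.2.one_le)) (by linarith)
  have hsub : (Finset.Ioc ⌊z⌋₊ ⌊4 * z⌋₊).filter Nat.Prime ⊆
      (Finset.Ioc ⌊z⌋₊ ⌊y⌋₊).filter Nat.Prime :=
    Finset.filter_subset_filter _ (Finset.Ioc_subset_Ioc_right (Nat.floor_mono hy))
  refine le_trans ?_ ((Finset.sum_le_sum hterm).trans
    (Finset.sum_le_sum_of_subset_of_nonneg hsub fun p _ _ => by positivity))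
  rw [← Finset.sum_div, ← Chebyshev.theta_sub_theta (by linarith),
    div_le_div_iff₀ (by positivity) (by positivity)]
  have h1 := hT (4 * z) (by linarith)
  have h2 := Chebyshev.theta_le_log4_mul_x (x := z) (by linarith)
  have h3 : Real.log 4 = 2 * Real.log 2 := by
    rw [show (4 : ℝ) = 2 ^ 2 by norm_num, Real.log_pow]
    norm_num
  have h4 := Real.log_two_lt_d9
  have h5 : z / 2 ≤ Chebyshev.theta (4 * z) - Chebyshev.theta z := by nlinarith
  nlinarith

/-- A quantitative form of the divergence of the sum of the reciprocals of the primes. -/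
theorem exists_forall_sum_one_div_prime_ge : ∃ T : ℝ, 2 ≤ T ∧ ∀ t, T ≤ t → ∀ (S : ℕ) (y : ℝ),
    4 ^ S * t ≤ y →
      S / (8 * Real.log y) ≤ ∑ p ∈ Finset.Ioc ⌊t⌋₊ ⌊y⌋₊ with p.Prime, 1 / (p : ℝ) := by
  obtain ⟨T, hT⟩ := exists_forall_sum_one_div_prime_ge_of_four_mul_le
  refine ⟨max T 2, le_max_right _ _, fun t ht S => ?_⟩
  have ht2 : 2 ≤ t := (le_max_right _ _).trans ht
  induction S with
  | zero =>
    intro y _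
    rw [Nat.cast_zero, zero_div]
    positivity
  | succ S ih =>
    intro y hy
    have h4S : (1 : ℝ) ≤ 4 ^ S := one_le_pow₀ (by norm_num)
    set z : ℝ := 4 ^ S * t with hz
    have hzt : t ≤ z := by nlinarith
    have hzy : 4 * z ≤ y := by rw [hz]; rw [pow_succ] at hy; linarith
    have hlogz : 0 < Real.log z := Real.log_pos (by linarith)
    have hlog : Real.log z ≤ Real.log y := Real.log_le_log (by linarith) (by linarith)
    have h1 := hT z ((le_max_left _ _).trans (ht.trans hzt)) (by linarith) y hzy
    have h2 : S / (8 * Real.log y) ≤ S / (8 * Real.log z) := by gcongr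
    have h3 := ih z le_rfl
    rw [Finset.sum_filter] at h1 h3 ⊢
    rw [← Finset.sum_Ioc_consecutive _ (Nat.floor_mono hzt)
      (Nat.floor_mono (show z ≤ y by linarith))]
    push_cast
    rw [add_div]
    linarith

theorem eventually_sum_one_div_prime_ge {δ : ℝ} (hδ0 : 0 < δ) (hδ1 : δ < 1) :
    ∀ᶠ y : ℝ in Filter.atTop,
      δ / 32 ≤ ∑ p ∈ Finset.Ioc ⌊y ^ (1 - δ)⌋₊ ⌊y⌋₊ with p.Prime, 1 / (p : ℝ) := by
  obtain ⟨T, hT2, hT⟩ := exists_forall_sum_one_div_prime_ge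
  filter_upwards [(tendsto_rpow_atTop (show 0 < 1 - δ by linarith)).eventually_ge_atTop T,
    Real.tendsto_log_atTop.eventually_ge_atTop (8 / δ), Filter.eventually_ge_atTop 2]
    with y hy1 hy2 hy3
  have hy0 : 0 < y := by linarith
  have hlog : 0 < Real.log y := Real.log_pos (by linarith)
  have hlog4 : Real.log 4 = 2 * Real.log 2 := by
    rw [show (4 : ℝ) = 2 ^ 2 by norm_num, Real.log_pow]
    norm_num
  have h4 := Real.log_two_lt_d9
  have h5 := Real.log_two_gt_d9
  rw [div_le_iff₀ hδ0] at hy2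
  refine le_trans ?_ (hT _ hy1 ⌊δ * Real.log y / Real.log 4⌋₊ y ?_)
  · rw [div_le_div_iff₀ (by norm_num) (by positivity)]
    have h6 := Nat.lt_floor_add_one (δ * Real.log y / Real.log 4)
    rw [div_lt_iff₀ (by linarith)] at h6
    have h7 : (0 : ℝ) ≤ ⌊δ * Real.log y / Real.log 4⌋₊ := Nat.cast_nonneg _
    rw [hlog4] at *
    nlinarith
  · have h8 : (4 : ℝ) ^ ⌊δ * Real.log y / Real.log 4⌋₊ ≤ y ^ δ := by
      rw [← Real.log_le_log_iff (by positivity) (by positivity), Real.log_rpow hy0, Real.log_pow,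
        ← le_div_iff₀ (by linarith)]
      exact Nat.floor_le (div_nonneg (by positivity) (by linarith))
    calc _ ≤ y ^ δ * y ^ (1 - δ) := by gcongr
      _ = y := by rw [← Real.rpow_add hy0, add_sub_cancel, Real.rpow_one]

open Finset in
/-- A weak form of Chebyshev's lower bound for the number of primes up to `z`. -/
theorem eventually_le_card_filter_prime : ∀ᶠ z : ℝ in Filter.atTop,
    z / (2 * Real.log z) ≤ #{p ∈ Icc 1 ⌊z⌋₊ | p.Prime} := by
  filter_upwards [Chebyshev.eventually_half_mul_le_theta, Filter.eventually_ge_atTop 2]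
    with z hz hz2
  have hlog : 0 < Real.log z := Real.log_pos (by linarith)
  have hcard : #{p ∈ Icc 1 ⌊z⌋₊ | p.Prime} = Nat.primeCounting ⌊z⌋₊ := by
    rw [← Nat.primesLE_card_eq_primeCounting]
    congr 1
    ext p
    rw [mem_filter, mem_Icc, Nat.mem_primesLE]
    exact ⟨fun h => ⟨h.1.2, h.2⟩, fun h => ⟨⟨h.2.one_le, h.1⟩, h.2⟩⟩
  rw [hcard, div_le_iff₀ (by positivity)]
  have := Chebyshev.theta_le_pi_mul_log' z
  linarith

open Finset in
/-- A positive integer is the product of at most `r!` sequences of primes of length `r`. -/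
theorem card_filter_prod_eq_le_factorial {k j : ℕ} (A : Finset ((Fin k → ℕ) × (Fin j → ℕ)))
    (hA : ∀ h ∈ A, (∀ i, (h.1 i).Prime) ∧ ∀ i, (h.2 i).Prime) (n : ℕ) :
    #{h ∈ A | (∏ i, h.1 i) * ∏ i, h.2 i = n} ≤ (k + j).factorial := by
  classical
  rcases ({h ∈ A | (∏ i, h.1 i) * ∏ i, h.2 i = n}).eq_empty_or_nonempty with h0 | ⟨h₀, hh₀⟩
  · rw [h0]
    simp
  let F : (Fin k → ℕ) × (Fin j → ℕ) → List ℕ := fun h => List.ofFn h.1 ++ List.ofFn h.2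
  have hF : ∀ h ∈ ({h ∈ A | (∏ i, h.1 i) * ∏ i, h.2 i = n} : Finset _),
      (F h).Perm n.primeFactorsList := by
    intro h hh
    rw [mem_filter] at hh
    refine Nat.primeFactorsList_unique ?_ ?_
    · rw [List.prod_append, List.prod_ofFn, List.prod_ofFn, hh.2]
    · intro p hp
      rw [List.mem_append, List.mem_ofFn, List.mem_ofFn] at hp
      rcases hp with ⟨i, rfl⟩ | ⟨i, rfl⟩
      exacts [(hA h hh.1).1 i, (hA h hh.1).2 i]
  have hlen : n.primeFactorsList.length = k + j := by
    rw [← (hF h₀ hh₀).length_eq]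
    simp [F]
  calc _ ≤ #n.primeFactorsList.permutations.toFinset := by
        refine card_le_card_of_injOn F (fun h hh => ?_) fun g _ h _ hgh => ?_
        · rw [mem_coe, List.mem_toFinset, List.mem_permutations]
          exact hF h hh
        · obtain ⟨h1, h2⟩ := List.append_inj hgh (by simp)
          exact Prod.ext (List.ofFn_injective h1) (List.ofFn_injective h2)
    _ ≤ n.primeFactorsList.permutations.length := List.toFinset_card_le _
    _ = (k + j).factorial := by rw [List.length_permutations, hlen]

open Finset in
/-- Lower bound for the number of `y`-smooth integers in `[2, x]`, obtained by counting products
`p₁ ⋯ p_k q₁ ⋯ q_j` of primes with `p_i ∈ P` and `q_i ≤ (x / (p₁ ⋯ p_k)) ^ (1 / j)`. -/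
theorem exists_smooth_finset {x y w T : ℝ} {k j : ℕ} {P : Finset ℕ} (hx : 0 < x) (hw : 0 < w)
    (hj : j ≠ 0) (hy : 1 < y) (hT1 : 1 < T)
    (hT : ∀ z, T ≤ z → z / (2 * Real.log z) ≤ #{p ∈ Finset.Icc 1 ⌊z⌋₊ | p.Prime})
    (hP : ∀ p ∈ P, p.Prime ∧ w ≤ p ∧ (p : ℝ) ≤ y) (h1 : x ≤ w ^ k * y ^ j)
    (h2 : y ^ k * T ^ j ≤ x) :
    ∃ S : Finset ℕ, (∀ n ∈ S, 2 ≤ n) ∧ (∀ n ∈ S, (n : ℝ) ≤ x) ∧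
      (∀ n ∈ S, ∀ p ∈ n.primeFactors, (p : ℝ) ≤ y) ∧
      x * (1 / (2 * Real.log y)) ^ j * (∑ p ∈ P, 1 / (p : ℝ)) ^ k ≤ (k + j).factorial * #S := by
  classical
  let Z : (Fin k → ℕ) → ℝ := fun f => (x / ∏ i, (f i : ℝ)) ^ (1 / j : ℝ)
  let Q : ℝ → Finset ℕ := fun z => {p ∈ Finset.Icc 1 ⌊z⌋₊ | p.Prime}
  let D : Finset (Fin k → ℕ) := Fintype.piFinset fun _ => P
  let A : Finset ((Fin k → ℕ) × (Fin j → ℕ)) :=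
    D.biUnion fun f => (Fintype.piFinset fun _ => Q (Z f)).map ⟨fun g => (f, g),
      fun g g' h => congrArg Prod.snd h⟩
  have hD : ∀ f ∈ D, ∀ i, f i ∈ P := fun f hf => Fintype.mem_piFinset.1 hf
  have hprodpos : ∀ f ∈ D, 0 < ∏ i, (f i : ℝ) := fun f hf =>
    prod_pos fun i _ => by exact_mod_cast (hP _ (hD f hf i)).1.pos
  have hZpow : ∀ f ∈ D, Z f ^ j = x / ∏ i, (f i : ℝ) := by
    intro f hf
    have := hprodpos f hf
    rw [← Real.rpow_natCast, ← Real.rpow_mul (by positivity), one_div_mul_cancel (by simpa),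
      Real.rpow_one]
  have hZ0 : ∀ f ∈ D, 0 ≤ Z f := fun f hf => by
    have := hprodpos f hf
    positivity
  have hZT : ∀ f ∈ D, T ≤ Z f := by
    intro f hf
    have hpos := hprodpos f hf
    refine le_of_pow_le_pow_left₀ hj (hZ0 f hf) ?_
    rw [hZpow f hf, le_div_iff₀ hpos]
    refine le_trans ?_ h2
    rw [mul_comm]
    gcongr
    calc ∏ i, (f i : ℝ) ≤ ∏ i : Fin k, y :=
          prod_le_prod (fun i _ => Nat.cast_nonneg _) fun i _ => (hP _ (hD f hf i)).2.2
      _ = y ^ k := by simp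
  have hZy : ∀ f ∈ D, Z f ≤ y := by
    intro f hf
    have hpos := hprodpos f hf
    refine le_of_pow_le_pow_left₀ hj (by linarith) ?_
    rw [hZpow f hf, div_le_iff₀ hpos]
    refine h1.trans ?_
    rw [mul_comm]
    gcongr
    calc w ^ k = ∏ i : Fin k, w := by simp
      _ ≤ ∏ i, (f i : ℝ) := prod_le_prod (fun i _ => hw.le) fun i _ => (hP _ (hD f hf i)).2.1
  have hQ : ∀ f ∈ D, ∀ q ∈ Q (Z f), q.Prime ∧ (q : ℝ) ≤ Z f := by
    intro f hf q hq
    rw [mem_filter, mem_Icc] at hq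
    exact ⟨hq.2, (Nat.le_floor_iff (hZ0 f hf)).1 hq.1.2⟩
  have hA : ∀ h ∈ A, h.1 ∈ D ∧ ∀ i, h.2 i ∈ Q (Z h.1) := by
    intro h hh
    obtain ⟨f, hf, hh⟩ := mem_biUnion.1 hh
    obtain ⟨g, hg, rfl⟩ := mem_map.1 hh
    exact ⟨hf, Fintype.mem_piFinset.1 hg⟩
  have hAprime : ∀ h ∈ A, (∀ i, (h.1 i).Prime) ∧ ∀ i, (h.2 i).Prime := fun h hh =>
    ⟨fun i => (hP _ (hD _ (hA h hh).1 i)).1, fun i => (hQ _ (hA h hh).1 _ ((hA h hh).2 i)).1⟩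
  have hcardA : #A = ∑ f ∈ D, #(Q (Z f)) ^ j := by
    rw [card_biUnion]
    · simp
    · intro f _ f' _ hff'
      rw [Function.onFun, disjoint_left]
      intro h hh hh'
      obtain ⟨g, _, rfl⟩ := mem_map.1 hh
      obtain ⟨g', _, h'⟩ := mem_map.1 hh'
      exact hff' (congrArg Prod.fst h').symm
  let Φ : (Fin k → ℕ) × (Fin j → ℕ) → ℕ := fun h => (∏ i, h.1 i) * ∏ i, h.2 i
  refine ⟨A.image Φ, ?_, ?_, ?_, ?_⟩
  · intro n hn
    obtain ⟨h, hh, rfl⟩ := mem_image.1 hn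
    obtain ⟨hp1, hp2⟩ := hAprime h hh
    let i₀ : Fin j := ⟨0, Nat.pos_of_ne_zero hj⟩
    refine (hp2 i₀).two_le.trans (Nat.le_of_dvd ?_ ?_)
    · exact Nat.mul_pos (prod_pos fun i _ => (hp1 i).pos) (prod_pos fun i _ => (hp2 i).pos)
    · exact (dvd_prod_of_mem _ (mem_univ i₀)).mul_left _
  · intro n hn
    obtain ⟨h, hh, rfl⟩ := mem_image.1 hn
    have hf := (hA h hh).1
    have hpos := hprodpos _ hf
    push_cast [Φ]
    calc (∏ i, (h.1 i : ℝ)) * ∏ i, (h.2 i : ℝ) ≤ (∏ i, (h.1 i : ℝ)) * ∏ i : Fin j, Z h.1 := by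
          gcongr with i
          exact (hQ _ hf _ ((hA h hh).2 i)).2
      _ = x := by
          rw [prod_const, card_univ, Fintype.card_fin, hZpow _ hf, mul_div_cancel₀ _ hpos.ne']
  · intro n hn p hp
    obtain ⟨h, hh, rfl⟩ := mem_image.1 hn
    have hf := (hA h hh).1
    obtain ⟨hp1, hp2⟩ := hAprime h hh
    have hpp := Nat.prime_of_mem_primeFactors hp
    rcases hpp.dvd_mul.1 (Nat.dvd_of_mem_primeFactors hp) with hd | hd
    · obtain ⟨i, _, hi⟩ := (hpp.prime.dvd_finsetProd_iff _).1 hd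
      rw [(Nat.prime_dvd_prime_iff_eq hpp (hp1 i)).1 hi]
      exact (hP _ (hD _ hf i)).2.2
    · obtain ⟨i, _, hi⟩ := (hpp.prime.dvd_finsetProd_iff _).1 hd
      rw [(Nat.prime_dvd_prime_iff_eq hpp (hp2 i)).1 hi]
      exact (hQ _ hf _ ((hA h hh).2 i)).2.trans (hZy _ hf)
  · have hcard : #A ≤ (k + j).factorial * #(A.image Φ) :=
      card_le_mul_card_image A _ fun n _ => card_filter_prod_eq_le_factorial A hAprime n
    refine le_trans ?_ (by exact_mod_cast hcard : (#A : ℝ) ≤ (k + j).factorial * #(A.image Φ))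
    rw [hcardA, sum_pow', mul_sum]
    push_cast
    refine sum_le_sum fun f hf => ?_
    have hpos := hprodpos f hf
    have hlogZ : 0 < Real.log (Z f) := Real.log_pos (hT1.trans_le (hZT f hf))
    calc x * (1 / (2 * Real.log y)) ^ j * ∏ i, 1 / (f i : ℝ)
        = (Z f / (2 * Real.log y)) ^ j := by
          rw [div_pow (Z f), hZpow f hf, prod_div_distrib, prod_const_one, div_pow, one_pow]
          ring
      _ ≤ (Z f / (2 * Real.log (Z f))) ^ j := by
          have := hZT f hf
          have := hZy f hf
          have : 0 < Z f := by linarith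
          have : 0 < Real.log y := Real.log_pos hy
          gcongr
      _ ≤ (#(Q (Z f)) : ℝ) ^ j := by
          have := hZ0 f hf
          gcongr
          exact hT _ (hZT f hf)

/-- Choice of the numbers of prime factors used in `exists_smooth_finset`, for `x = exp X` and
`y = exp Y`. -/
theorem exists_number_of_factors {δ X Y : ℝ} (hδ0 : 0 < δ) (hδ1 : δ ≤ 1 / 4) (hX : 0 < X)
    (hY : 0 < Y) (hXY : 2 * Y ^ 2 = X * Real.log X) (hlogX : 8 ≤ Real.log X)
    (hδX : Real.log (32 / δ) ≤ δ * Real.log X) (hXlog : 4 / δ ^ 2 * Real.log X ≤ X) :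
    ∃ k j : ℕ, j ≠ 0 ∧ X ≤ (1 - δ) * Y * k + Y * j ∧
      (∀ t, 0 ≤ t → 3 * t ≤ Y → Y * k + t * j ≤ X) ∧
      j * Real.log (2 * Y) + k * Real.log (32 / δ) + (k + j) * Real.log (k + j) + Y +
        Real.log 2 ≤ (2 + 11 * δ) * Y := by
  set ℓ := Real.log X with hℓ
  set u := X / Y with hu
  have hu0 : 0 < u := by positivity
  have huY : u * Y = X := by rw [hu]; field_simp
  have huℓ : u * ℓ = 2 * Y := by rw [hu]; field_simp; linarith
  have hu2 : u ^ 2 * ℓ = 2 * X := by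
    rw [← huY, sq, mul_assoc, huℓ]
    ring
  have huδ : 2 ≤ δ * u := by
    have h1 : 4 * ℓ ≤ δ ^ 2 * X := by
      rw [div_mul_eq_mul_div, div_le_iff₀ (by positivity)] at hXlog
      linarith
    have h2 : 4 * ℓ ≤ (δ * u) ^ 2 * ℓ := by
      rw [mul_pow, mul_assoc, hu2]
      nlinarith
    have h3 : (2 : ℝ) ^ 2 ≤ (δ * u) ^ 2 := by
      norm_num
      exact le_of_mul_le_mul_right h2 (by linarith)
    exact le_of_pow_le_pow_left₀ two_ne_zero (by positivity) h3
  have hYX : 2 * Y ≤ X := by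
    have hu8 : 8 ≤ u := by nlinarith
    nlinarith
  have hY8 : 1 ≤ δ * Y := by nlinarith
  refine ⟨⌊(1 - δ) * u⌋₊, ⌈2 * δ * u⌉₊ + 1, Nat.succ_ne_zero _, ?_⟩
  have hk1 := Nat.lt_floor_add_one ((1 - δ) * u)
  have hk2 := Nat.floor_le (show 0 ≤ (1 - δ) * u by nlinarith)
  have hj1 := Nat.le_ceil (2 * δ * u)
  have hj2 := Nat.ceil_lt_add_one (show 0 ≤ 2 * δ * u by positivity)
  push_cast
  set k : ℝ := ((⌊(1 - δ) * u⌋₊ : ℕ) : ℝ)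
  set m : ℝ := ((⌈2 * δ * u⌉₊ : ℕ) : ℝ)
  have hk0 : 0 ≤ k := Nat.cast_nonneg _
  have hm0 : 0 ≤ m := Nat.cast_nonneg _
  have hm3 : m + 1 ≤ 3 * δ * u := by linarith
  refine ⟨?_, fun t ht0 ht => ?_, ?_⟩
  · have h1 : u ≤ (1 - δ) * k + (m + 1) := by nlinarith [mul_nonneg hδ0.le hδ0.le]
    calc X = u * Y := huY.symm
      _ ≤ ((1 - δ) * k + (m + 1)) * Y := by gcongr
      _ = _ := by ring
  · calc Y * k + t * (m + 1) ≤ Y * ((1 - δ) * u) + t * (3 * δ * u) := by gcongr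
      _ = Y * ((1 - δ) * u) + (3 * t) * (δ * u) := by ring
      _ ≤ Y * ((1 - δ) * u) + Y * (δ * u) := by gcongr
      _ = X := by rw [← huY]; ring
  · have h1 : (m + 1) * Real.log (2 * Y) ≤ 6 * δ * Y := by
      calc (m + 1) * Real.log (2 * Y) ≤ (m + 1) * ℓ := by
            gcongr
            exact Real.log_le_log (by positivity) hYX
        _ ≤ 3 * δ * u * ℓ := by gcongr
        _ = 6 * δ * Y := by rw [mul_assoc, huℓ]; ring
    have h2 : k * Real.log (32 / δ) ≤ 2 * δ * Y := by
      calc k * Real.log (32 / δ) ≤ k * (δ * ℓ) := by gcongr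
        _ ≤ u * (δ * ℓ) := by gcongr; nlinarith
        _ = δ * (u * ℓ) := by ring
        _ = 2 * δ * Y := by rw [huℓ]; ring
    have h3 : k + (m + 1) ≤ (1 + 2 * δ) * u := by linarith
    have h4 : Real.log (k + (m + 1)) ≤ ℓ / 2 := by
      have h5 : (k + (m + 1)) ^ 2 ≤ X := by
        calc (k + (m + 1)) ^ 2 ≤ (2 * u) ^ 2 := by gcongr; nlinarith
          _ ≤ X := by nlinarith [sq_nonneg u]
      have h6 := Real.log_le_log (by positivity) h5
      rw [Real.log_pow] at h6
      push_cast at h6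
      linarith
    have h5 : (k + (m + 1)) * Real.log (k + (m + 1)) ≤ (1 + 2 * δ) * Y := by
      calc (k + (m + 1)) * Real.log (k + (m + 1)) ≤ (k + (m + 1)) * (ℓ / 2) := by gcongr
        _ ≤ (1 + 2 * δ) * u * (ℓ / 2) := by gcongr
        _ = (1 + 2 * δ) * (u * ℓ) / 2 := by ring
        _ = (1 + 2 * δ) * Y := by rw [huℓ]; ring
    have h6 := Real.log_two_lt_d9
    linarith

open Filter in
/-- For large `x`, the estimate for the number of smooth integers with the optimal smoothness
parameter `exp Y`, where `2 Y ^ 2 = log x * log log x`. -/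
theorem eventually_exists_smooth_finset {δ : ℝ} (hδ0 : 0 < δ) (hδ1 : δ ≤ 1 / 4) :
    ∀ᶠ x : ℝ in atTop, ∀ Y : ℝ, Y = √(Real.log x * Real.log (Real.log x) / 2) →
      ∃ S : Finset ℕ, (∀ n ∈ S, 2 ≤ n) ∧ (∀ n ∈ S, (n : ℝ) ≤ x) ∧
        (∀ n ∈ S, ∀ p ∈ n.primeFactors, (p : ℝ) ≤ Real.exp Y) ∧
        x * Real.exp (-((2 + 11 * δ) * Y)) ≤ (S.card : ℝ) / (2 * Real.exp Y) := by
  obtain ⟨T, hT⟩ := eventually_atTop.1 eventually_le_card_filter_prime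
  have hX := Real.tendsto_log_atTop
  have hℓ := hX.comp hX
  have hXlog : ∀ᶠ X : ℝ in atTop, 4 / δ ^ 2 * Real.log X ≤ X := by
    filter_upwards [Real.isLittleO_log_id_atTop.bound (show 0 < δ ^ 2 / 4 by positivity),
      eventually_ge_atTop 0] with X hX hX0
    rw [id, Real.norm_of_nonneg hX0] at hX
    have := (le_abs_self _).trans hX
    rw [div_mul_eq_mul_div, div_le_iff₀ (by positivity)]
    linarith
  have hY : Tendsto (fun x : ℝ => √(Real.log x * Real.log (Real.log x) / 2)) atTop atTop :=
    Real.tendsto_sqrt_atTop.comp ((hX.atTop_mul_atTop₀ hℓ).atTop_div_const two_pos)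
  filter_upwards [hX.eventually_gt_atTop 0, hℓ.eventually_ge_atTop 8,
    hℓ.eventually_ge_atTop (Real.log (32 / δ) / δ), hX.eventually hXlog,
    hY.eventually_ge_atTop (3 * Real.log (max T 2)), hY.eventually_gt_atTop 0,
    (Real.tendsto_exp_atTop.comp hY).eventually
      (eventually_sum_one_div_prime_ge hδ0 (by linarith)), eventually_gt_atTop 0]
    with x hX0 hℓ8 hℓδ hXlog hYT hY0 hsum hx0 Y hYdef
  simp only [Function.comp_apply] at hℓ8 hℓδ hsum
  rw [← hYdef] at hYT hY0 hsum
  rw [div_le_iff₀' hδ0] at hℓδ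
  set X := Real.log x with hXdef
  have hxX : x = Real.exp X := (Real.exp_log hx0).symm
  have hXY : 2 * Y ^ 2 = X * Real.log X := by
    rw [hYdef, Real.sq_sqrt (by positivity)]
    ring
  obtain ⟨k, j, hj, hkj1, hkj2, hkj3⟩ :=
    exists_number_of_factors hδ0 hδ1 hX0 hY0 hXY hℓ8 hℓδ hXlog
  have hT1 : 1 < max T 2 := lt_of_lt_of_le one_lt_two (le_max_right _ _)
  have hP : ∀ p ∈ (Finset.Ioc ⌊Real.exp Y ^ (1 - δ)⌋₊ ⌊Real.exp Y⌋₊).filter Nat.Prime,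
      p.Prime ∧ Real.exp Y ^ (1 - δ) ≤ p ∧ (p : ℝ) ≤ Real.exp Y := by
    intro p hp
    rw [Finset.mem_filter, Finset.mem_Ioc] at hp
    exact ⟨hp.2, (Nat.lt_of_floor_lt hp.1.1).le, (Nat.le_floor_iff (Real.exp_pos _).le).1 hp.1.2⟩
  have hupper : x ≤ (Real.exp Y ^ (1 - δ)) ^ k * Real.exp Y ^ j := by
    rw [hxX, ← Real.exp_mul, ← Real.exp_nat_mul, ← Real.exp_nat_mul, ← Real.exp_add,
      Real.exp_le_exp]
    linarith
  have hlower : Real.exp Y ^ k * max T 2 ^ j ≤ x := by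
    have h1 := hkj2 (Real.log (max T 2)) (Real.log_nonneg hT1.le) hYT
    rw [hxX, ← Real.exp_log (show 0 < max T 2 by linarith), ← Real.exp_nat_mul,
      ← Real.exp_nat_mul, ← Real.exp_add, Real.exp_le_exp]
    linarith
  obtain ⟨S, hS2, hSx, hSy, hcard⟩ := exists_smooth_finset hx0 (by positivity) hj
    (Real.one_lt_exp_iff.2 hY0) hT1 (fun z hz => hT z ((le_max_left _ _).trans hz)) hP hupper
    hlower
  refine ⟨S, hS2, hSx, hSy, ?_⟩
  rw [Real.log_exp] at hcard
  have hfac : ((k + j).factorial : ℝ) ≤ Real.exp ((k + j) * Real.log (k + j)) := by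
    have hpos : (0 : ℝ) < k + j := by
      have : 0 < j := Nat.pos_of_ne_zero hj
      positivity
    have h1 := Real.exp_nat_mul (Real.log (k + j)) (k + j)
    rw [Real.exp_log hpos] at h1
    push_cast at h1
    rw [h1]
    exact_mod_cast Nat.factorial_le_pow (k + j)
  have hpj : (1 / (2 * Y)) ^ j = Real.exp (-(j * Real.log (2 * Y))) := by
    rw [Real.exp_neg, Real.exp_nat_mul, Real.exp_log (by positivity), one_div, inv_pow]
  have hpk : (δ / 32) ^ k = Real.exp (-(k * Real.log (32 / δ))) := by
    rw [Real.exp_neg, Real.exp_nat_mul, Real.exp_log (by positivity), ← inv_pow, inv_div]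
  have hcard' : x * (1 / (2 * Y)) ^ j * (δ / 32) ^ k ≤ (k + j).factorial * S.card := by
    refine le_trans ?_ hcard
    gcongr
  have hfac0 : (0 : ℝ) < (k + j).factorial := by exact_mod_cast Nat.factorial_pos _
  rw [le_div_iff₀ (by positivity)]
  refine le_of_mul_le_mul_left (le_trans ?_ hcard') hfac0
  calc (k + j).factorial * (x * Real.exp (-((2 + 11 * δ) * Y)) * (2 * Real.exp Y))
      ≤ Real.exp ((k + j) * Real.log (k + j)) *
        (x * Real.exp (-((2 + 11 * δ) * Y)) * (2 * Real.exp Y)) := by gcongr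
    _ = Real.exp ((k + j) * Real.log (k + j) + (X + -((2 + 11 * δ) * Y) +
        (Real.log 2 + Y))) := by
      rw [Real.exp_add, Real.exp_add, Real.exp_add, Real.exp_add, Real.exp_log two_pos, ← hxX]
    _ ≤ Real.exp (X + -(j * Real.log (2 * Y)) + -(k * Real.log (32 / δ))) :=
      Real.exp_le_exp.2 (by linarith)
    _ = _ := by rw [Real.exp_add, Real.exp_add, ← hxX, hpj, hpk]

/-- Lower bound: for every `ε > 0` there is `x₀ ≥ 3` such that for all `x ≥ x₀`,
`w(x) ≥ x · exp(−(√2 + ε)·√(log x · log log x))`. -/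
theorem w_lower_bound
    (W : ℝ → ℕ)
    (hW : ∀ x : ℝ, 3 ≤ x → IsGreatest {w : ℕ | ProductIsPerfectPower x w} (W x)) :
    ∀ ε : ℝ, 0 < ε → ∃ x₀ : ℝ, 3 ≤ x₀ ∧ ∀ x : ℝ, x₀ ≤ x →
      x * Real.exp (-(Real.sqrt 2 + ε) *
        Real.sqrt (Real.log x * Real.log (Real.log x))) ≤ (W x : ℝ) := by
  intro ε hε
  obtain ⟨δ, hδ0, hδ1, hδε⟩ : ∃ δ : ℝ, 0 < δ ∧ δ ≤ 1 / 4 ∧ 11 * δ ≤ ε :=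
    ⟨min (1 / 4) (ε / 11), by positivity, min_le_left _ _,
      by linarith [min_le_right (1 / 4) (ε / 11)]⟩
  have hlarge : ∀ᶠ X : ℝ in Filter.atTop, (2 + 11 * δ) * √(X * Real.log X / 2) ≤ X := by
    filter_upwards [Real.isLittleO_log_id_atTop.bound
      (show 0 < 2 / (2 + 11 * δ) ^ 2 by positivity), Filter.eventually_ge_atTop 0] with X hX hX0
    rw [id, Real.norm_of_nonneg hX0] at hX
    have h1 := (le_abs_self _).trans hX
    rw [div_mul_eq_mul_div, le_div_iff₀ (by positivity)] at h1
    rw [← le_div_iff₀' (by positivity), Real.sqrt_le_left (by positivity), div_pow,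
      le_div_iff₀ (by positivity)]
    nlinarith
  obtain ⟨x₀, hx₀⟩ := Filter.eventually_atTop.1
    ((eventually_exists_smooth_finset hδ0 hδ1).and
      ((Real.tendsto_log_atTop.eventually hlarge).and (Filter.eventually_ge_atTop 3)))
  refine ⟨max x₀ 3, le_max_right _ _, fun x hx => ?_⟩
  obtain ⟨hS, hlog, hx3⟩ := hx₀ x ((le_max_left _ _).trans hx)
  set Y := √(Real.log x * Real.log (Real.log x) / 2) with hY
  obtain ⟨S, hS2, hSx, hSy, hcard⟩ := hS Y rfl
  have hY0 : 0 ≤ Y := Real.sqrt_nonneg _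
  have hsqrt : Real.sqrt (Real.log x * Real.log (Real.log x)) = √2 * Y := by
    rw [hY, ← Real.sqrt_mul zero_le_two, mul_div_cancel₀ _ two_ne_zero]
  have hbig : 1 ≤ x * Real.exp (-((2 + 11 * δ) * Y)) := by
    rw [Real.exp_neg, ← div_eq_mul_inv, one_le_div (Real.exp_pos _),
      ← Real.le_log_iff_exp_le (by linarith)]
    exact hlog
  have hcard2 : 2 * Real.exp Y ≤ S.card := by
    have := hbig.trans hcard
    rwa [one_le_div (by positivity)] at this
  obtain ⟨q, hq, hpow⟩ := exists_productIsPerfectPower (Real.exp_pos Y) hS2 hSx hSy hcard2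
  have hqW : (q : ℝ) ≤ W x := by exact_mod_cast (hW x hx3).2 hpow
  refine le_trans ?_ ((hcard.trans hq).trans hqW)
  gcongr
  rw [hsqrt]
  have h1 : (1 : ℝ) ≤ √2 := Real.one_le_sqrt.2 one_le_two
  have h2 : (√2 + ε) * (√2 * Y) = 2 * Y + ε * (√2 * Y) := by
    linear_combination Y * Real.mul_self_sqrt (zero_le_two (α := ℝ))
  have h3 : 11 * δ * Y ≤ ε * (√2 * Y) := by
    have h4 : Y ≤ √2 * Y := le_mul_of_one_le_left hY0 h1
    gcongr
  linarith
end

section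
/- Let x ≥ 3 be a real number, let m ≥ 1, y ≥ 2 and w ≥ 1 be integers, and let 1 ≤ n₁ < n₂ < ⋯ < n_m ≤ x be integers with n₁·n₂⋯n_m = y^w. Let q := P⁺(y) be the largest prime factor of y. Then w ≤ Ψ(x/q, q)·(log x / log q). -/
open Real

/-- `Psi X z` : the number of positive integers `n ≤ X` all of whose prime factors
are `≤ z` (the number of `z`-friable integers up to `X`). -/
noncomputable def Psi (X z : ℝ) : ℕ :=
  Nat.card {n : ℕ // 0 < n ∧ (n : ℝ) ≤ X ∧ ∀ p : ℕ, p.Prime → p ∣ n → (p : ℝ) ≤ z}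

/-- `maxPrimeFac y` : the largest prime factor of `y` (for `y ≥ 2`). -/
def maxPrimeFac (y : ℕ) : ℕ := y.primeFactors.sup id

theorem maxPrimeFac_mem_primeFactors {y : ℕ} (hy : 2 ≤ y) : maxPrimeFac y ∈ y.primeFactors := by
  obtain ⟨p, hp, h⟩ := Finset.exists_mem_eq_sup y.primeFactors
    (Nat.nonempty_primeFactors.2 (by lia)) id
  rwa [maxPrimeFac, h]

theorem le_maxPrimeFac {p y : ℕ} (hp : p ∈ y.primeFactors) : p ≤ maxPrimeFac y :=
  Finset.le_sup (f := id) hp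

/-- Finitely many distinct positive `z`-friable integers up to `X` number at most `Psi X z`. -/
theorem card_le_Psi {X z : ℝ} (s : Finset ℕ)
    (hs : ∀ n ∈ s, 0 < n ∧ (n : ℝ) ≤ X ∧ ∀ p : ℕ, p.Prime → p ∣ n → (p : ℝ) ≤ z) :
    s.card ≤ Psi X z := by
  have hfin : {n : ℕ | 0 < n ∧ (n : ℝ) ≤ X ∧
      ∀ p : ℕ, p.Prime → p ∣ n → (p : ℝ) ≤ z}.Finite :=
    (Set.finite_Iic ⌊X⌋₊).subset fun n hn => Nat.le_floor hn.2.1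
  rw [← Set.ncard_coe_finset s]
  exact Set.ncard_le_ncard hs hfin

theorem factorization_le_log_div_log {q n : ℕ} {x : ℝ} (hq : q.Prime) (hn : n ≠ 0)
    (hnx : (n : ℝ) ≤ x) : (n.factorization q : ℝ) ≤ Real.log x / Real.log q := by
  have hlog : 0 < Real.log q := Real.log_pos (by exact_mod_cast hq.one_lt)
  rw [le_div_iff₀ hlog, ← Real.log_pow]
  refine Real.log_le_log (pow_pos (by exact_mod_cast hq.pos) _) (le_trans ?_ hnx)
  exact_mod_cast Nat.ordProj_le q hn

/-- If `1 ≤ n₁ < ⋯ < n_m ≤ x` and `n₁ ⋯ n_m = y ^ w` with `y ≥ 2`, `w ≥ 1`, `m ≥ 1`,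
and `q := P⁺(y)`, then `w ≤ Ψ(x/q, q) · (log x / log q)`. -/
theorem w_le_Psi_mul_log_div_log
    (x : ℝ) (hx : 3 ≤ x) (m y w : ℕ) (hm : 1 ≤ m) (hy : 2 ≤ y) (hw : 1 ≤ w)
    (n : Fin m → ℕ) (hmono : StrictMono n) (hn1 : ∀ i, 1 ≤ n i)
    (hnx : ∀ i, (n i : ℝ) ≤ x) (hprod : ∏ i, n i = y ^ w) :
    (w : ℝ) ≤ (Psi (x / (maxPrimeFac y : ℝ)) (maxPrimeFac y) : ℝ) *
      (Real.log x / Real.log (maxPrimeFac y)) := by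
  set q := maxPrimeFac y with hqdef
  have hqmem : q ∈ y.primeFactors := maxPrimeFac_mem_primeFactors hy
  have hq : q.Prime := Nat.prime_of_mem_primeFactors hqmem
  have hy0 : y ≠ 0 := by lia
  have hn0 : ∀ i, n i ≠ 0 := fun i => Nat.one_le_iff_ne_zero.1 (hn1 i)
  have hdvd : ∀ i, n i ∣ y ^ w := fun i => hprod ▸ Finset.dvd_prod_of_mem n (Finset.mem_univ i)
  let S : Finset (Fin m) := Finset.univ.filter fun i => q ∣ n i
  have hwsum : w ≤ ∑ i ∈ S, (n i).factorization q := by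
    have hsum : ∑ i, (n i).factorization q = w * y.factorization q := by
      have h := congrArg (fun k => k.factorization q) hprod
      simpa [Nat.factorization_prod fun i _ => hn0 i] using h
    have hval : 1 ≤ y.factorization q :=
      hq.factorization_pos_of_dvd hy0 (Nat.dvd_of_mem_primeFactors hqmem)
    rw [Finset.sum_filter_of_ne fun i _ h => Nat.dvd_of_factorization_pos h, hsum]
    exact Nat.le_mul_of_pos_right w hval
  have hScard : S.card ≤ Psi (x / q) q := by
    have hinj : Set.InjOn (fun i => n i / q) S := fun i hi j hj hij =>
      hmono.injective ((Nat.div_left_inj (Finset.mem_filter.1 hi).2 (Finset.mem_filter.1 hj).2).1 hij)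
    rw [← Finset.card_image_of_injOn hinj]
    refine card_le_Psi _ fun k hk => ?_
    obtain ⟨i, hi, rfl⟩ := Finset.mem_image.1 hk
    have hqi : q ∣ n i := (Finset.mem_filter.1 hi).2
    refine ⟨Nat.div_pos (Nat.le_of_dvd (hn1 i) hqi) hq.pos, ?_, fun p hp hpk => ?_⟩
    · exact Nat.cast_div_le.trans (by gcongr; exact hnx i)
    · have hpy : p ∣ y :=
        hp.dvd_of_dvd_pow ((hpk.trans (Nat.div_dvd_of_dvd hqi)).trans (hdvd i))
      exact_mod_cast le_maxPrimeFac (Nat.mem_primeFactors.2 ⟨hp, hpy, hy0⟩)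
  have hnonneg : 0 ≤ Real.log x / Real.log q :=
    div_nonneg (Real.log_nonneg (by linarith)) (Real.log_natCast_nonneg q)
  calc (w : ℝ) ≤ ∑ i ∈ S, ((n i).factorization q : ℝ) := by exact_mod_cast hwsum
    _ ≤ S.card • (Real.log x / Real.log q) := Finset.sum_le_card_nsmul _ _ _ fun i _ =>
        factorization_le_log_div_log hq (hn0 i) (hnx i)
    _ = S.card * (Real.log x / Real.log q) := nsmul_eq_mul _ _
    _ ≤ Psi (x / q) q * (Real.log x / Real.log q) := by gcongr
end

section
/- Let x ≥ 3 be a real number, q a prime, and let 1 ≤ n₁ < n₂ < ⋯ < n_m ≤ x be integers all of whose prime factors are ≤ q. Then the q-adic valuation of the product n₁·n₂⋯n_m satisfies v_q(n₁·n₂⋯n_m) ≤ Ψ(x/q, q)·(log x / log q). -/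
open Real

/-- A sequence of distinct `q`-friable integers in `[1, x]` has at most `Ψ(x/q, q)` terms
divisible by `q`. -/
theorem card_filter_dvd_le_Psi (x : ℝ) {q : ℕ} (hq : 0 < q) {ι : Type*} [Fintype ι]
    (n : ι → ℕ) (hinj : Function.Injective n) (hn1 : ∀ i, 1 ≤ n i) (hnx : ∀ i, (n i : ℝ) ≤ x)
    (hfriable : ∀ i, ∀ p : ℕ, p.Prime → p ∣ n i → p ≤ q) :
    (Finset.univ.filter fun i => q ∣ n i).card ≤ Psi (x / (q : ℝ)) (q : ℝ) := by
  have hfin : Finite {k : ℕ // 0 < k ∧ (k : ℝ) ≤ x / q ∧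
      ∀ p : ℕ, p.Prime → p ∣ k → (p : ℝ) ≤ q} :=
    Set.Finite.to_subtype <| (Set.finite_Iic ⌊x / q⌋₊).subset fun k hk => Nat.le_floor hk.2.1
  rw [Psi, ← Fintype.card_coe, ← Nat.card_eq_fintype_card]
  have hdvd (i : Finset.univ.filter fun i => q ∣ n i) : q ∣ n i := (Finset.mem_filter.1 i.2).2
  refine Nat.card_le_card_of_injective (fun i => ⟨n i / q, ?_, ?_, ?_⟩) ?_
  · exact Nat.div_pos (Nat.le_of_dvd (hn1 i) (hdvd i)) hq
  · exact Nat.cast_div_le.trans (by gcongr; exact hnx i)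
  · intro p hp hpi
    exact_mod_cast hfriable i p hp (hpi.trans (Nat.div_dvd_of_dvd (hdvd i)))
  · intro i j hij
    exact Subtype.ext (hinj ((Nat.div_left_inj (hdvd i) (hdvd j)).1 (Subtype.mk.inj hij)))

/-- The `q`-adic valuation of a positive integer `k ≤ x` is at most `log x / log q`. -/
theorem factorization_le_log_div_log_s5 {x : ℝ} {q k : ℕ} (hq : 1 < q) (hk : 0 < k)
    (hkx : (k : ℝ) ≤ x) : (k.factorization q : ℝ) ≤ Real.log x / Real.log q := by
  rw [le_div_iff₀ (Real.log_pos (by exact_mod_cast hq)), ← Real.log_pow]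
  refine Real.log_le_log (by positivity) (le_trans ?_ hkx)
  exact_mod_cast Nat.le_of_dvd hk (Nat.ordProj_dvd k q)

/-- If `1 ≤ n₁ < ⋯ < n_m ≤ x` are `q`-friable, then the `q`-adic valuation of their
product is at most `Ψ(x/q, q) · (log x / log q)`. -/
theorem valuation_prod_le (x : ℝ) (hx : 3 ≤ x) (q : ℕ) (hq : q.Prime)
    (m : ℕ) (n : Fin m → ℕ) (hmono : StrictMono n) (hn1 : ∀ i, 1 ≤ n i)
    (hnx : ∀ i, (n i : ℝ) ≤ x)
    (hfriable : ∀ i, ∀ p : ℕ, p.Prime → p ∣ n i → p ≤ q) :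
    ((∏ i, n i).factorization q : ℝ) ≤
      (Psi (x / (q : ℝ)) (q : ℝ) : ℝ) * (Real.log x / Real.log q) := by
  have hlog : 0 ≤ Real.log x / Real.log q :=
    div_nonneg (Real.log_nonneg (by linarith)) (Real.log_natCast_nonneg q)
  rw [Nat.factorization_prod fun i _ => Nat.ne_of_gt (hn1 i), Finsupp.finsetSum_apply,
    Nat.cast_sum]
  calc ∑ i, ((n i).factorization q : ℝ)
      = ∑ i ∈ Finset.univ.filter fun i => q ∣ n i, ((n i).factorization q : ℝ) := by
        refine (Finset.sum_filter_of_ne fun i _ hi => ?_).symm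
        by_contra hqi
        exact hi (by rw [Nat.factorization_eq_zero_of_not_dvd hqi, Nat.cast_zero])
    _ ≤ (Finset.univ.filter fun i => q ∣ n i).card • (Real.log x / Real.log q) :=
        Finset.sum_le_card_nsmul _ _ _ fun i _ =>
          factorization_le_log_div_log_s5 hq.one_lt (hn1 i) (hnx i)
    _ ≤ (Psi (x / (q : ℝ)) (q : ℝ) : ℝ) * (Real.log x / Real.log q) := by
        rw [nsmul_eq_mul]
        gcongr
        exact card_filter_dvd_le_Psi x hq.pos n hmono.injective hn1 hnx hfriable
end
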